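/- Let β > 0, 0 < α < 4/(d+n), and for τ > 0 let u_τ be a minimizer of μ_{1,τ} = inf{E^τ(u) : u ∈ S(1)}, where E^τ(u) = (τ/2)‖Δ_y u‖₂² + (βτ/2)‖∇_y u‖₂² + (1/(2τ))‖Δ_x u‖₂² + (β/2)‖∇_x u‖₂² - (1/(α+2))‖u‖_{α+2}^{α+2}. Then lim_{τ→∞} μ_{1,τ} = (2π)^n μ̂^∞_{(2π)^{-n}}, where μ̂^∞_c = inf{(β/2)‖∇_x u‖_{L²(ℝ^d)}² - (1/(α+2))‖u‖_{L^{α+2}(ℝ^d)}^{α+2} : u ∈ H²(ℝ^d), ‖u‖_{L²}² = c}. -/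

import Mathlib

noncomputable section

open MeasureTheory Real Filter Set

namespace BNLS

/-- A point of `ℝ^d × 𝕋^n`, the torus being modelled by periodic functions on `ℝ^n`. -/
abbrev Pt (d n : ℕ) := (Fin d → ℝ) × (Fin n → ℝ)

/-- Fundamental domain `[0,2π)^n` of the torus `(ℝ/2πℤ)^n`. -/
def torusBox (n : ℕ) : Set (Fin n → ℝ) := Set.univ.pi fun _ => Set.Ico 0 (2*π)

/-- The measure of the torus `𝕋^n`. -/
def μT (n : ℕ) : Measure (Fin n → ℝ) := volume.restrict (torusBox n)

/-- The measure of `ℝ^d × 𝕋^n`. -/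
def μP (d n : ℕ) : Measure (Pt d n) := (volume : Measure (Fin d → ℝ)).prod (μT n)

/-- Partial derivative in the `i`-th `x`-direction. -/
def dX (d n : ℕ) (i : Fin d) (u : Pt d n → ℂ) : Pt d n → ℂ :=
  fun p => fderiv ℝ u p (Pi.single i 1, 0)

/-- Partial derivative in the `j`-th `y`-direction. -/
def dY (d n : ℕ) (j : Fin n) (u : Pt d n → ℂ) : Pt d n → ℂ :=
  fun p => fderiv ℝ u p (0, Pi.single j 1)

/-- Partial Laplacian `Δ_x`. -/
def lapX (d n : ℕ) (u : Pt d n → ℂ) : Pt d n → ℂ := fun p => ∑ i, dX d n i (dX d n i u) p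

/-- Partial Laplacian `Δ_y`. -/
def lapY (d n : ℕ) (u : Pt d n → ℂ) : Pt d n → ℂ := fun p => ∑ j, dY d n j (dY d n j u) p

/-- Full Laplacian `Δ_{x,y}`. -/
def lap (d n : ℕ) (u : Pt d n → ℂ) : Pt d n → ℂ := fun p => lapX d n u p + lapY d n u p

/-- Mass `‖u‖_{L²}²`. -/
def Mass (d n : ℕ) (u : Pt d n → ℂ) : ℝ := ∫ z, ‖u z‖^2 ∂(μP d n)

/-- `‖u‖_{L^p}^p`. -/
def Npow (d n : ℕ) (p : ℝ) (u : Pt d n → ℂ) : ℝ := ∫ z, ‖u z‖ ^ p ∂(μP d n)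

/-- The `L^p` norm. -/
def LpN (d n : ℕ) (p : ℝ) (u : Pt d n → ℂ) : ℝ := (Npow d n p u) ^ (1/p)

/-- `‖Δ u‖_{L²}²`. -/
def lapSq (d n : ℕ) (u : Pt d n → ℂ) : ℝ := ∫ z, ‖lap d n u z‖^2 ∂(μP d n)

/-- `‖Δ_x u‖_{L²}²`. -/
def lapXSq (d n : ℕ) (u : Pt d n → ℂ) : ℝ := ∫ z, ‖lapX d n u z‖^2 ∂(μP d n)

/-- `‖Δ_y u‖_{L²}²`. -/
def lapYSq (d n : ℕ) (u : Pt d n → ℂ) : ℝ := ∫ z, ‖lapY d n u z‖^2 ∂(μP d n)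

/-- `‖∇_x u‖_{L²}²`. -/
def gradXSq (d n : ℕ) (u : Pt d n → ℂ) : ℝ := ∫ z, (∑ i, ‖dX d n i u z‖^2) ∂(μP d n)

/-- `‖∇_y u‖_{L²}²`. -/
def gradYSq (d n : ℕ) (u : Pt d n → ℂ) : ℝ := ∫ z, (∑ j, ‖dY d n j u z‖^2) ∂(μP d n)

/-- `‖∇ u‖_{L²}²`. -/
def gradSq (d n : ℕ) (u : Pt d n → ℂ) : ℝ := gradXSq d n u + gradYSq d n u

/-- Pointwise sum of squares of all second derivatives. -/
def hessInt (d n : ℕ) (u : Pt d n → ℂ) (z : Pt d n) : ℝ :=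
  (∑ i, ∑ i', ‖dX d n i (dX d n i' u) z‖^2) + (∑ i, ∑ j, ‖dY d n j (dX d n i u) z‖^2)
  + (∑ j, ∑ i, ‖dX d n i (dY d n j u) z‖^2) + (∑ j, ∑ j', ‖dY d n j (dY d n j' u) z‖^2)

/-- `‖∇² u‖_{L²}²`. -/
def hessSq (d n : ℕ) (u : Pt d n → ℂ) : ℝ := ∫ z, hessInt d n u z ∂(μP d n)

/-- The `H²` norm on `ℝ^d × 𝕋^n`. -/
def H2norm (d n : ℕ) (u : Pt d n → ℂ) : ℝ :=
  Real.sqrt (Mass d n u + gradSq d n u + hessSq d n u)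

/-- `2π`-periodicity in all `y`-variables. -/
def Periodic (d n : ℕ) (u : Pt d n → ℂ) : Prop :=
  ∀ j : Fin n, ∀ p : Pt d n, u (p.1, p.2 + (2*π) • (Pi.single j 1 : Fin n → ℝ)) = u p

/-- Membership in `H²(ℝ^d × 𝕋^n)`. -/
def InH2 (d n : ℕ) (u : Pt d n → ℂ) : Prop :=
  ContDiff ℝ 2 u ∧ Periodic d n u ∧
  Integrable (fun z => ‖u z‖^2) (μP d n) ∧
  Integrable (fun z => (∑ i, ‖dX d n i u z‖^2) + ∑ j, ‖dY d n j u z‖^2) (μP d n) ∧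
  Integrable (hessInt d n u) (μP d n)

/-- The mass sphere `S(c)`. -/
def Sset (d n : ℕ) (c : ℝ) : Set (Pt d n → ℂ) := {u | InH2 d n u ∧ Mass d n u = c}

/-- The energy functional `E`. -/
def En (d n : ℕ) (β α : ℝ) (u : Pt d n → ℂ) : ℝ :=
  (1/2) * lapSq d n u + (β/2) * gradSq d n u - (1/(α+2)) * Npow d n (α+2) u

/-- The ground state energy `m_c`. -/
def mC (d n : ℕ) (β α c : ℝ) : ℝ := sInf (En d n β α '' Sset d n c)

end BNLS

namespace BNLS

/-- Partial derivative on `ℝ^d`. -/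
def dXd (d : ℕ) (i : Fin d) (u : (Fin d → ℝ) → ℂ) : (Fin d → ℝ) → ℂ :=
  fun x => fderiv ℝ u x (Pi.single i 1)

/-- Laplacian on `ℝ^d`. -/
def lapd (d : ℕ) (u : (Fin d → ℝ) → ℂ) : (Fin d → ℝ) → ℂ :=
  fun x => ∑ i, dXd d i (dXd d i u) x

/-- Mass on `ℝ^d`. -/
def Massd (d : ℕ) (u : (Fin d → ℝ) → ℂ) : ℝ := ∫ x, ‖u x‖^2

/-- `‖u‖_{L^p(ℝ^d)}^p`. -/
def Npowd (d : ℕ) (p : ℝ) (u : (Fin d → ℝ) → ℂ) : ℝ := ∫ x, ‖u x‖ ^ p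

/-- `‖∇u‖_{L²(ℝ^d)}²`. -/
def gradSqd (d : ℕ) (u : (Fin d → ℝ) → ℂ) : ℝ := ∫ x, ∑ i, ‖dXd d i u x‖^2

/-- `‖Δu‖_{L²(ℝ^d)}²`. -/
def lapSqd (d : ℕ) (u : (Fin d → ℝ) → ℂ) : ℝ := ∫ x, ‖lapd d u x‖^2

/-- Membership in `H²(ℝ^d)`. -/
def InH2d (d : ℕ) (u : (Fin d → ℝ) → ℂ) : Prop :=
  ContDiff ℝ 2 u ∧
  Integrable (fun x => ‖u x‖^2) ∧
  Integrable (fun x => ∑ i, ‖dXd d i u x‖^2) ∧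
  Integrable (fun x => ∑ i, ∑ i', ‖dXd d i (dXd d i' u) x‖^2)

/-- The energy `Ê` on `ℝ^d` with `β = 0`. -/
def Enhat (d : ℕ) (α : ℝ) (u : (Fin d → ℝ) → ℂ) : ℝ :=
  (1/2) * lapSqd d u - (1/(α+2)) * Npowd d (α+2) u

/-- The ground state energy `m̂_c` on `ℝ^d` with `β = 0`. -/
def mhat (d : ℕ) (α c : ℝ) : ℝ :=
  sInf {r : ℝ | ∃ u : (Fin d → ℝ) → ℂ, InH2d d u ∧ Massd d u = c ∧ r = Enhat d α u}

end BNLS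

namespace BNLS

/-- The rescaled energy `E^τ` with mixed dispersion `β`. -/
def Etau (d n : ℕ) (τ β α : ℝ) (u : Pt d n → ℂ) : ℝ :=
  (τ/2) * lapYSq d n u + (β*τ/2) * gradYSq d n u + (1/(2*τ)) * lapXSq d n u
    + (β/2) * gradXSq d n u - (1/(α+2)) * Npow d n (α+2) u

/-- The rescaled ground state energy `μ_{1,τ}`. -/
def mu1tau (d n : ℕ) (τ β α : ℝ) : ℝ := sInf (Etau d n τ β α '' Sset d n 1)

/-- The limiting NLS ground state energy `μ̂^∞_c` on `ℝ^d`. -/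
def muHatInf (d : ℕ) (β α c : ℝ) : ℝ :=
  sInf {r : ℝ | ∃ u : (Fin d → ℝ) → ℂ, InH2d d u ∧ Massd d u = c ∧
    r = (β/2) * gradSqd d u - (1/(α+2)) * Npowd d (α+2) u}

end BNLS

section
open MeasureTheory Real Filter Set

lemma line_bound (h h' K : ℝ → ℝ) (hd : ∀ t, HasDerivAt h (h' t) t) (hK : Continuous K)
    (hb : ∀ t, h t + |h' t| ≤ K t) (a x : ℝ) (hx : x ∈ Icc a (a+1)) :
    h x ≤ ∫ t in a..(a+1), K t := by
  have hc : Continuous h := continuous_iff_continuousAt.2 fun t => (hd t).continuousAt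
  have hKh : Continuous (fun t => K t - h t) := hK.sub hc
  have hnn : ∀ t, 0 ≤ K t - h t := fun t => by have := hb t; have := abs_nonneg (h' t); linarith
  have hle : a ≤ a + 1 := by linarith
  have mono : ∀ p q, p ∈ Icc a (a+1) → q ∈ Icc a (a+1) → p ≤ q →
      ∫ t in p..q, (K t - h t) ≤ ∫ t in a..(a+1), (K t - h t) := by
    intro p q hp hq hpq
    apply intervalIntegral.integral_mono_interval hp.1 hpq hq.2
    · exact Eventually.of_forall hnn
    · exact hKh.intervalIntegrable _ _
  have key : ∀ t ∈ Icc a (a+1), h x ≤ h t + ∫ t in a..(a+1), (K t - h t) := by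
    intro t ht
    rcases le_total t x with htx | htx
    · have h1 := intervalIntegral.sub_le_integral_of_hasDeriv_right_of_le htx hc.continuousOn
        (fun y _ => (hd y).hasDerivWithinAt) (hKh.integrableOn_Icc)
        (fun y _ => by have := hb y; have := le_abs_self (h' y); linarith)
      have := mono t x ht hx htx
      linarith
    · have h1 := intervalIntegral.sub_le_integral_of_hasDeriv_right_of_le htx hc.neg.continuousOn
        (fun y _ => (hd y).neg.hasDerivWithinAt) (hKh.integrableOn_Icc)
        (fun y _ => by have := hb y; have := neg_le_abs (h' y); linarith)
      have := mono x t hx ht htx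
      simp only [Pi.neg_apply] at h1
      linarith
  have := intervalIntegral.integral_mono_on (μ := volume) hle (f := fun _ => h x)
    (g := fun t => h t + ∫ t in a..(a+1), (K t - h t)) (continuous_const.intervalIntegrable _ _)
    ((hc.add continuous_const).intervalIntegrable _ _) key
  rw [intervalIntegral.integral_add (hc.intervalIntegrable _ _) (continuous_const.intervalIntegrable _ _),
    intervalIntegral.integral_sub (hK.intervalIntegrable _ _) (hc.intervalIntegrable _ _)] at this
  simpa using this

lemma trunc_line (φ φ' : ℝ → ℂ) (hd : ∀ t, HasDerivAt φ (φ' t) t) (hc' : Continuous φ')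
    (ε b : ℝ) (hε : 0 < ε) (hb : 1 ≤ b) (a x : ℝ) (hx : x ∈ Icc a (a+1)) :
    (‖φ x‖^2 / (1 + ε * ‖φ x‖^2)) ^ b ≤ ∫ t in a..(a+1),
      2 * b * ((‖φ t‖^2 / (1 + ε * ‖φ t‖^2)) ^ (b - 1/2) * (‖φ t‖ + ‖φ' t‖)) := by
  have hc : Continuous φ := continuous_iff_continuousAt.2 fun t => (hd t).continuousAt
  have hpos : ∀ t, 0 < 1 + ε * ‖φ t‖^2 := fun t => by positivity
  have hs : ∀ t, HasDerivAt (fun t => ‖φ t‖^2) (2 * inner ℝ (φ t) (φ' t)) t := fun t =>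
    (hd t).norm_sq
  have hS : ∀ t, HasDerivAt (fun t => ‖φ t‖^2 / (1 + ε * ‖φ t‖^2))
      ((2 * inner ℝ (φ t) (φ' t)) / (1 + ε * ‖φ t‖^2)^2) t := by
    intro t
    have := (hs t).div (((hs t).const_mul ε).const_add 1) (hpos t).ne'
    refine this.congr_deriv ?_
    ring
  have hSnn : ∀ t, 0 ≤ ‖φ t‖^2 / (1 + ε * ‖φ t‖^2) := fun t => by positivity
  refine line_bound (fun t => (‖φ t‖^2 / (1 + ε * ‖φ t‖^2)) ^ b) _ _
    (fun t => (hS t).rpow_const (Or.inr hb)) ?_ ?_ a x hx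
  · have : Continuous fun t => ‖φ t‖^2 / (1 + ε * ‖φ t‖^2) :=
      Continuous.div (by fun_prop) (by fun_prop) fun t => (hpos t).ne'
    have h2 : Continuous fun t => (‖φ t‖^2 / (1 + ε * ‖φ t‖^2)) ^ (b - 1/2) :=
      this.rpow_const fun t => Or.inr (by linarith)
    fun_prop
  · intro t
    set N := ‖φ t‖
    set S := N^2 / (1 + ε * N^2) with hSdef
    have hN : 0 ≤ N := norm_nonneg _
    have hS0 : 0 ≤ S := hSnn t
    have hp : 0 < 1 + ε * N^2 := hpos t
    have h1p : 1 ≤ 1 + ε * N^2 := by have : 0 ≤ ε * N^2 := by positivity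
                                     linarith
    have hSN : S ≤ N^2 := by rw [hSdef]; exact div_le_self (by positivity) h1p
    have hsq : S ^ (1/2:ℝ) ≤ N := by
      rw [← Real.sqrt_eq_rpow]; exact Real.sqrt_le_iff.2 ⟨hN, hSN⟩
    have e1 : S ^ b = S ^ (b - 1/2) * S ^ (1/2:ℝ) := by
      rw [← Real.rpow_add' hS0 (by linarith)]; congr 1; ring
    have hq : 0 ≤ S ^ (b - 1/2) := by positivity
    have b1 : S ^ b ≤ 2 * b * (S ^ (b - 1/2) * N) := by
      rw [e1]
      have := mul_le_mul_of_nonneg_left hsq hq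
      have h3 : 0 ≤ S ^ (b - 1/2) * N := by positivity
      nlinarith
    have hin : |2 * inner ℝ (φ t) (φ' t)| ≤ 2 * (N * ‖φ' t‖) := by
      rw [abs_mul, abs_two]
      have := abs_real_inner_le_norm (φ t) (φ' t)
      linarith
    have hNd : N / (1 + ε * N^2)^2 ≤ S ^ (1/2:ℝ) := by
      rw [← Real.sqrt_eq_rpow]
      apply Real.le_sqrt_of_sq_le
      rw [hSdef, div_pow, ← pow_mul]
      apply div_le_div_of_nonneg_left (by positivity) hp
      exact le_self_pow₀ h1p (by norm_num)
    have hd1 : |2 * inner ℝ (φ t) (φ' t) / (1 + ε * N^2)^2| ≤ 2 * (S ^ (1/2:ℝ) * ‖φ' t‖) := by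
      rw [abs_div, abs_of_pos (by positivity : 0 < (1 + ε * N^2)^2)]
      calc _ ≤ 2 * (N * ‖φ' t‖) / (1 + ε * N^2)^2 := by gcongr
        _ = 2 * (N / (1 + ε * N^2)^2 * ‖φ' t‖) := by ring
        _ ≤ _ := by gcongr
    have e2 : S ^ (b-1) * S ^ (1/2:ℝ) = S ^ (b - 1/2) := by
      rw [← Real.rpow_add' hS0 (by linarith)]; congr 1; ring
    have b2 : |2 * inner ℝ (φ t) (φ' t) / (1 + ε * N^2)^2 * b * S ^ (b-1)| ≤
        2 * b * (S ^ (b - 1/2) * ‖φ' t‖) := by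
      rw [abs_mul, abs_mul, abs_of_nonneg (by positivity : 0 ≤ S ^ (b-1)), abs_of_nonneg (by linarith : 0 ≤ b)]
      calc _ ≤ 2 * (S ^ (1/2:ℝ) * ‖φ' t‖) * b * S ^ (b-1) := by gcongr
        _ = 2 * b * ((S ^ (b-1) * S ^ (1/2:ℝ)) * ‖φ' t‖) := by ring
        _ = _ := by rw [e2]
    calc _ ≤ 2 * b * (S ^ (b - 1/2) * N) + 2 * b * (S ^ (b - 1/2) * ‖φ' t‖) := add_le_add b1 b2
      _ = _ := by ring

end

section
open MeasureTheory Real Filter Set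
open scoped ENNReal Topology

lemma ennreal_absorb (P a : ℝ≥0∞) (hP : P ≠ ∞) (h : P ≤ a * P ^ (1/2:ℝ)) : P ≤ a ^ 2 := by
  rcases eq_or_ne P 0 with h0 | h0
  · simp [h0]
  have hs0 : P ^ (1/2:ℝ) ≠ 0 := by
    simp [ENNReal.rpow_eq_zero_iff, h0, hP]
  have hst : P ^ (1/2:ℝ) ≠ ∞ := ENNReal.rpow_ne_top_of_nonneg (by norm_num) hP
  have e : P = P ^ (1/2:ℝ) * P ^ (1/2:ℝ) := by
    rw [← ENNReal.rpow_add _ _ h0 hP]; norm_num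
  have h2 : P ^ (1/2:ℝ) ≤ a := by
    have : P ^ (1/2:ℝ) * P ^ (1/2:ℝ) ≤ a * P ^ (1/2:ℝ) := by rw [← e]; exact h
    exact (ENNReal.mul_le_mul_iff_left hs0 hst).1 this
  calc P = P ^ (1/2:ℝ) * P ^ (1/2:ℝ) := e
    _ ≤ a * a := mul_le_mul' h2 h2
    _ = a ^ 2 := (sq a).symm

lemma gn_trunc {ι : Type*} [Fintype ι] [DecidableEq ι] (hι : 2 ≤ Fintype.card ι) (J : ι → Set ℝ)
    (hJm : ∀ i, MeasurableSet (J i))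
    (hJ : ∀ i, ∀ x ∈ J i, ∃ a, x ∈ Icc a (a+1) ∧ Icc a (a+1) ⊆ J i)
    (u : (ι → ℝ) → ℂ) (hu : ContDiff ℝ 1 u) (ε : ℝ) (hε : 0 < ε)
    (hM : ∫⁻ z, ENNReal.ofReal (‖u z‖^2) ∂(Measure.pi fun i => volume.restrict (J i)) ≠ ∞) :
    ∫⁻ z, ENNReal.ofReal (‖u z‖^2 / (1 + ε * ‖u z‖^2)) ^ (1 + 2 / (Fintype.card ι : ℝ))
        ∂(Measure.pi fun i => volume.restrict (J i)) ≤
      ((∫⁻ z, ENNReal.ofReal (‖u z‖^2) ∂(Measure.pi fun i => volume.restrict (J i)))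
          ^ (1 / (Fintype.card ι : ℝ)) *
        (ENNReal.ofReal 3 *
        (∫⁻ z, (ENNReal.ofReal (‖u z‖ + ∑ i, ‖fderiv ℝ u z (Pi.single i 1)‖)) ^ (2:ℝ)
          ∂(Measure.pi fun i => volume.restrict (J i))) ^ (1/2:ℝ))) ^ 2 := by
  set μ := Measure.pi fun i => (volume : Measure ℝ).restrict (J i) with hμ
  set D : ℝ := (Fintype.card ι : ℝ) with hD
  have hD2 : (2:ℝ) ≤ D := by rw [hD]; exact_mod_cast hι
  set b : ℝ := 1 + 1 / D with hb
  have hD0 : 0 < D := by linarith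
  have hinv : 0 < 1 / D := by positivity
  have hinv' : 1 / D ≤ 1 / 2 := one_div_le_one_div_of_le (by norm_num) hD2
  have hb1 : 1 ≤ b := by linarith
  have hcu : Continuous u := hu.continuous
  have hcd : ∀ i, Continuous fun z => fderiv ℝ u z (Pi.single i 1) := fun i =>
    (hu.continuous_fderiv one_ne_zero).clm_apply continuous_const
  have hpos : ∀ z, 0 < 1 + ε * ‖u z‖^2 := fun z => by positivity
  have hSc : Continuous fun z => ‖u z‖^2 / (1 + ε * ‖u z‖^2) :=
      Continuous.div (by fun_prop) (by fun_prop) fun t => (hpos t).ne'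
  set X : (ι → ℝ) → ℝ≥0∞ := fun z => ENNReal.ofReal (‖u z‖^2 / (1 + ε * ‖u z‖^2)) with hX
  set h : (ι → ℝ) → ℝ≥0∞ :=
    fun z => ENNReal.ofReal (‖u z‖ + ∑ i, ‖fderiv ℝ u z (Pi.single i 1)‖) with hh
  have hXm : Measurable X := (ENNReal.continuous_ofReal.comp hSc).measurable
  have hhm : Measurable h := (ENNReal.continuous_ofReal.comp (by fun_prop)).measurable
  set F : (ι → ℝ) → ℝ≥0∞ := fun z => ENNReal.ofReal 3 * (X z ^ (b - 1/2) * h z) with hF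
  have hFm : Measurable F := ((hXm.pow_const _).mul hhm).const_mul _
  -- line estimate
  have line : ∀ z i, z i ∈ J i →
      X z ^ b ≤ ∫⁻ t, F (Function.update z i t) ∂(volume.restrict (J i)) := by
    intro z i hz
    obtain ⟨a, hxa, hsub⟩ := hJ i (z i) hz
    have hdl : ∀ t, HasDerivAt (fun t => u (Function.update z i t))
        (fderiv ℝ u (Function.update z i t) (Pi.single i 1)) t := fun t =>
      ((hu.differentiable one_ne_zero) _).hasFDerivAt.comp_hasDerivAt t (hasDerivAt_update z i t)
    have hupd : Continuous fun t : ℝ => Function.update z i t := continuous_const.update i continuous_id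
    have := trunc_line (fun t => u (Function.update z i t)) _ hdl
      ((hcd i).comp hupd) ε b hε hb1 a (z i) hxa
    rw [Function.update_eq_self] at this
    set Kf : ℝ → ℝ := fun t => 2 * b * ((‖u (Function.update z i t)‖ ^ 2 /
      (1 + ε * ‖u (Function.update z i t)‖ ^ 2)) ^ (b - 1 / 2) *
          (‖u (Function.update z i t)‖ + ‖fderiv ℝ u (Function.update z i t) (Pi.single i 1)‖)) with hKf
    have hSl : Continuous fun t => (‖u (Function.update z i t)‖ ^ 2 /
      (1 + ε * ‖u (Function.update z i t)‖ ^ 2)) ^ (b - 1 / 2) :=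
      (hSc.comp hupd).rpow_const fun t => Or.inr (by linarith)
    have hKc : Continuous Kf := by
      have := (hcd i).comp hupd
      have h3 := hcu.comp hupd
      simp only [Function.comp_def] at this h3
      fun_prop
    have hKnn : ∀ t, 0 ≤ Kf t := fun t => by
      simp only [hKf]; have := hpos (Function.update z i t); positivity
    have e1 : X z ^ b = ENNReal.ofReal ((‖u z‖^2 / (1 + ε * ‖u z‖^2)) ^ b) := by
      rw [hX, ENNReal.ofReal_rpow_of_nonneg (by have := hpos z; positivity) (by linarith)]
    rw [e1]
    calc _ ≤ ENNReal.ofReal (∫ t in a..(a+1), Kf t) := ENNReal.ofReal_le_ofReal this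
      _ = ∫⁻ t in Ioc a (a+1), ENNReal.ofReal (Kf t) := by
        rw [intervalIntegral.integral_of_le (by linarith), ofReal_integral_eq_lintegral_ofReal]
        · exact (hKc.integrableOn_Icc).mono_set Ioc_subset_Icc_self
        · exact Eventually.of_forall hKnn
      _ ≤ ∫⁻ t in J i, ENNReal.ofReal (Kf t) :=
        lintegral_mono_set (Ioc_subset_Icc_self.trans hsub)
      _ ≤ _ := by
        apply lintegral_mono
        intro t
        simp only [hF, hX, hh, hKf]
        have hp := hpos (Function.update z i t)
        rw [ENNReal.ofReal_rpow_of_nonneg (by positivity) (by linarith),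
          ← ENNReal.ofReal_mul (by positivity), ← ENNReal.ofReal_mul (by norm_num)]
        apply ENNReal.ofReal_le_ofReal
        have hs : ‖fderiv ℝ u (Function.update z i t) (Pi.single i 1)‖ ≤
            ∑ k, ‖fderiv ℝ u (Function.update z i t) (Pi.single k 1)‖ :=
          Finset.single_le_sum (f := fun k => ‖fderiv ℝ u (Function.update z i t) (Pi.single k 1)‖)
            (fun _ _ => norm_nonneg _) (Finset.mem_univ i)
        gcongr
        linarith
  have conj : Real.HolderConjugate (Fintype.card ι : ℝ) (D / (D - 1)) :=
    Real.HolderConjugate.conjExponent (by linarith)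
  have hae : ∀ᵐ z ∂μ, ∀ i, z i ∈ J i := by
    rw [hμ, ← Measure.restrict_pi_pi]
    filter_upwards [ae_restrict_mem (MeasurableSet.univ_pi hJm)] with z hz i using hz i (mem_univ i)
  have hq0 : 0 < D - 1 := by linarith
  have lw : ∫⁻ z, (X z ^ b) ^ (D / (D - 1)) ∂μ ≤ (∫⁻ z, F z ∂μ) ^ (D / (D - 1)) := by
    refine le_trans ?_ (lintegral_prod_lintegral_pow_le (fun i => volume.restrict (J i)) conj hFm)
    apply lintegral_mono_ae
    filter_upwards [hae] with z hz
    have : (X z ^ b) ^ (D / (D - 1)) = ∏ i : ι, (X z ^ b) ^ (1 / (D - 1)) := by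
      rw [Finset.prod_const, Finset.card_univ, ← ENNReal.rpow_natCast, ← hD,
        ← ENNReal.rpow_mul (X z ^ b)]
      congr 1
      field_simp
    rw [this]
    apply Finset.prod_le_prod' 
    intro i _
    exact ENNReal.rpow_le_rpow (line z i (hz i)) (by positivity)
  have lw' : (∫⁻ z, (X z ^ b) ^ (D / (D - 1)) ∂μ) ^ (1 / (D / (D-1))) ≤ ∫⁻ z, F z ∂μ := by
    calc _ ≤ ((∫⁻ z, F z ∂μ) ^ (D / (D - 1))) ^ (1 / (D / (D-1))) :=
          ENNReal.rpow_le_rpow lw (by positivity)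
      _ = _ := by rw [← ENNReal.rpow_mul, mul_one_div_cancel (by positivity), ENNReal.rpow_one]
  have hXle : ∀ z, X z ≤ ENNReal.ofReal (‖u z‖^2) := fun z =>
    ENNReal.ofReal_le_ofReal (div_le_self (by positivity)
      (by have : 0 ≤ ε * ‖u z‖^2 := by positivity
          linarith))
  set P := ∫⁻ z, X z ^ (1 + 2 / D) ∂μ with hP
  have i1 : P ≤ (∫⁻ z, ENNReal.ofReal (‖u z‖^2) ∂μ) ^ (1/D) * ∫⁻ z, F z ∂μ := by
    have hol := ENNReal.lintegral_mul_le_Lp_mul_Lq μ conj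
      (f := fun z => X z ^ (1/D)) (g := fun z => X z ^ b)
      (hXm.pow_const _).aemeasurable (hXm.pow_const _).aemeasurable
    have e : ∀ z, ((fun z => X z ^ (1/D)) * fun z => X z ^ b) z = X z ^ (1 + 2/D) := by
      intro z
      simp only [Pi.mul_apply]
      rw [← ENNReal.rpow_add_of_nonneg _ _ hinv.le (by linarith)]
      congr 1; rw [hb]; ring
    simp only [e] at hol
    refine hol.trans (mul_le_mul' ?_ lw')
    apply ENNReal.rpow_le_rpow _ hinv.le
    apply lintegral_mono
    intro z
    beta_reduce
    rw [← ENNReal.rpow_mul, ← hD, one_div_mul_cancel hD0.ne', ENNReal.rpow_one]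
    exact hXle z
  have i2 : ∫⁻ z, F z ∂μ ≤ ENNReal.ofReal 3 * (P ^ (1/2:ℝ) * (∫⁻ z, h z ^ (2:ℝ) ∂μ) ^ (1/2:ℝ)) := by
    change ∫⁻ z, ENNReal.ofReal 3 * (X z ^ (b - 1/2) * h z) ∂μ ≤ _
    rw [lintegral_const_mul' _ _ ENNReal.ofReal_ne_top]
    have hol := ENNReal.lintegral_mul_le_Lp_mul_Lq μ (Real.HolderConjugate.two_two)
      (f := fun z => X z ^ (b - 1/2)) (g := h)
      (hXm.pow_const _).aemeasurable hhm.aemeasurable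
    simp only [← ENNReal.rpow_mul] at hol
    have e : (b - 1/2) * 2 = 1 + 2/D := by rw [hb]; ring
    rw [e] at hol
    exact mul_le_mul_right hol _
  have hPfin : P ≠ ∞ := by
    have : P ≤ ENNReal.ofReal (1/ε) ^ (2/D) * ∫⁻ z, ENNReal.ofReal (‖u z‖^2) ∂μ := by
      rw [← lintegral_const_mul' _ _ (ENNReal.rpow_ne_top_of_nonneg (by positivity) ENNReal.ofReal_ne_top)]
      apply lintegral_mono
      intro z
      simp only []
      rw [add_comm, ENNReal.rpow_add_of_nonneg _ _ (by positivity) (by norm_num), ENNReal.rpow_one]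
      refine mul_le_mul' (ENNReal.rpow_le_rpow ?_ (by positivity)) (hXle z)
      apply ENNReal.ofReal_le_ofReal
      rw [div_le_div_iff₀ (hpos z) hε]
      nlinarith [sq_nonneg ‖u z‖]
    refine ne_top_of_le_ne_top (ENNReal.mul_ne_top ?_ hM) this
    exact ENNReal.rpow_ne_top_of_nonneg (by positivity) ENNReal.ofReal_ne_top
  refine ennreal_absorb P _ hPfin (i1.trans ((mul_le_mul_right i2 _).trans (le_of_eq ?_)))
  ring

end

section
open MeasureTheory Real Filter Set
open scoped ENNReal Topology

lemma gn_pi {ι : Type*} [Fintype ι] [DecidableEq ι] (hι : 2 ≤ Fintype.card ι) (J : ι → Set ℝ)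
    (hJm : ∀ i, MeasurableSet (J i))
    (hJ : ∀ i, ∀ x ∈ J i, ∃ a, x ∈ Icc a (a+1) ∧ Icc a (a+1) ⊆ J i)
    (u : (ι → ℝ) → ℂ) (hu : ContDiff ℝ 1 u)
    (hM : ∫⁻ z, ENNReal.ofReal (‖u z‖^2) ∂(Measure.pi fun i => volume.restrict (J i)) ≠ ∞) :
    ∫⁻ z, ENNReal.ofReal (‖u z‖^2) ^ (1 + 2 / (Fintype.card ι : ℝ))
        ∂(Measure.pi fun i => volume.restrict (J i)) ≤
      ((∫⁻ z, ENNReal.ofReal (‖u z‖^2) ∂(Measure.pi fun i => volume.restrict (J i)))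
          ^ (1 / (Fintype.card ι : ℝ)) *
        (ENNReal.ofReal 3 *
        (∫⁻ z, (ENNReal.ofReal (‖u z‖ + ∑ i, ‖fderiv ℝ u z (Pi.single i 1)‖)) ^ (2:ℝ)
          ∂(Measure.pi fun i => volume.restrict (J i))) ^ (1/2:ℝ))) ^ 2 := by
  have hT : ∀ k : ℕ, _ := fun k => gn_trunc hι J hJm hJ u hu (1/((k:ℝ)+1)) (by positivity) hM
  set R := ((∫⁻ z, ENNReal.ofReal (‖u z‖^2) ∂(Measure.pi fun i => volume.restrict (J i)))
          ^ (1 / (Fintype.card ι : ℝ)) *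
        (ENNReal.ofReal 3 *
        (∫⁻ z, (ENNReal.ofReal (‖u z‖ + ∑ i, ‖fderiv ℝ u z (Pi.single i 1)‖)) ^ (2:ℝ)
          ∂(Measure.pi fun i => volume.restrict (J i))) ^ (1/2:ℝ))) ^ 2
  have hlim : ∀ z, Tendsto (fun k : ℕ => ENNReal.ofReal (‖u z‖^2 / (1 + (1/((k:ℝ)+1)) * ‖u z‖^2))
      ^ (1 + 2 / (Fintype.card ι : ℝ))) atTop
      (𝓝 (ENNReal.ofReal (‖u z‖^2) ^ (1 + 2 / (Fintype.card ι : ℝ)))) := by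
    intro z
    apply Tendsto.ennrpow_const
    apply ENNReal.tendsto_ofReal
    have h0 := tendsto_one_div_add_atTop_nhds_zero_nat (𝕜 := ℝ)
    have := (tendsto_const_nhds (x := ‖u z‖^2)).div
      ((tendsto_const_nhds (x := (1:ℝ))).add (h0.mul_const (‖u z‖^2))) (by simp)
    simpa [Pi.div_def] using this
  have hcu := hu.continuous
  calc _ = ∫⁻ z, liminf (fun k : ℕ => ENNReal.ofReal (‖u z‖^2 / (1 + (1/((k:ℝ)+1)) * ‖u z‖^2))
      ^ (1 + 2 / (Fintype.card ι : ℝ))) atTop ∂(Measure.pi fun i => volume.restrict (J i)) := by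
        apply lintegral_congr
        intro z
        exact (hlim z).liminf_eq.symm
    _ ≤ liminf (fun k : ℕ => ∫⁻ z, ENNReal.ofReal (‖u z‖^2 / (1 + (1/((k:ℝ)+1)) * ‖u z‖^2))
      ^ (1 + 2 / (Fintype.card ι : ℝ)) ∂(Measure.pi fun i => volume.restrict (J i))) atTop := by
        apply lintegral_liminf_le
        intro k
        apply Measurable.pow_const
        apply Continuous.measurable
        apply ENNReal.continuous_ofReal.comp
        exact Continuous.div (by fun_prop) (by fun_prop) fun t => by positivity
    _ ≤ R := by
        refine (liminf_le_liminf (v := fun _ : ℕ => R) (Eventually.of_forall hT)).trans ?_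
        simp

end

section
open MeasureTheory Real Filter Set
open scoped ENNReal Topology

namespace BNLS

lemma μP_map (d n : ℕ) : MeasurePreserving (MeasurableEquiv.sumPiEquivProdPi (fun _ : Fin d ⊕ Fin n => ℝ))
    (Measure.pi fun i => (volume : Measure ℝ).restrict
      (Sum.elim (fun _ => univ) (fun _ => Ico 0 (2*π)) i)) (μP d n) := by
  have := measurePreserving_sumPiEquivProdPi (X := fun _ : Fin d ⊕ Fin n => ℝ)
    (fun i => (volume : Measure ℝ).restrict
      ((Sum.elim (fun _ => univ) (fun _ => Ico 0 (2*π)) i : Set ℝ)))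
  convert this using 1
  simp only [Sum.elim_inl, Sum.elim_inr, Measure.restrict_univ]
  rw [← Measure.restrict_pi_pi]
  rfl

lemma gn_Pt (d n : ℕ) (hd : 1 ≤ d) (hn : 1 ≤ n) (u : Pt d n → ℂ) (hu : ContDiff ℝ 1 u)
    (hM : Integrable (fun z => ‖u z‖^2) (μP d n))
    (hX : Integrable (fun z => ∑ i, ‖dX d n i u z‖^2) (μP d n))
    (hY : Integrable (fun z => ∑ j, ‖dY d n j u z‖^2) (μP d n)) :
    Integrable (fun z => ‖u z‖ ^ (2 + 4 / ((d:ℝ)+n))) (μP d n) ∧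
    Npow d n (2 + 4 / ((d:ℝ)+n)) u ≤ 9 * ((d:ℝ)+n+1) * Mass d n u ^ (2 / ((d:ℝ)+n)) *
      (Mass d n u + gradXSq d n u + gradYSq d n u) := by
  set D : ℝ := (d:ℝ) + n with hD
  have hd' : (1:ℝ) ≤ d := by exact_mod_cast hd
  have hn' : (1:ℝ) ≤ n := by exact_mod_cast hn
  have hD0 : 0 < D := by linarith
  have hcard : (Fintype.card (Fin d ⊕ Fin n) : ℝ) = D := by simp [hD]
  have hmp := μP_map d n
  set L := ContinuousLinearEquiv.sumPiEquivProdPi ℝ (Fin d) (Fin n) (fun _ => ℝ) with hL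
  have hLe : ∀ z, MeasurableEquiv.sumPiEquivProdPi (fun _ : Fin d ⊕ Fin n => ℝ) z = L z := fun z => rfl
  have hu2 : ContDiff ℝ 1 (fun z => u (L z)) := hu.comp L.contDiff
  have hfd : ∀ z v, fderiv ℝ (fun z => u (L z)) z v = fderiv ℝ u (L z) (L v) := by
    intro z v
    have h1 : HasFDerivAt u (fderiv ℝ u (L z)) (L z) :=
      ((hu.differentiable one_ne_zero) _).hasFDerivAt
    have := h1.comp z L.hasFDerivAt
    rw [show (fun z => u (L z)) = u ∘ L from rfl, this.fderiv]
    rfl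
  have hLl : ∀ i, L (Pi.single (Sum.inl i) 1) = (Pi.single i 1, 0) := by
    intro i
    ext k
    · change (Pi.single (Sum.inl i) 1 : Fin d ⊕ Fin n → ℝ) (Sum.inl k) = _
      simp [Pi.single_apply]
    · change (Pi.single (Sum.inl i) 1 : Fin d ⊕ Fin n → ℝ) (Sum.inr k) = _
      simp [Pi.single_apply]
  have hLr : ∀ i, L (Pi.single (Sum.inr i) 1) = (0, Pi.single i 1) := by
    intro i
    ext k
    · change (Pi.single (Sum.inr i) 1 : Fin d ⊕ Fin n → ℝ) (Sum.inl k) = _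
      simp [Pi.single_apply]
    · change (Pi.single (Sum.inr i) 1 : Fin d ⊕ Fin n → ℝ) (Sum.inr k) = _
      simp [Pi.single_apply]
  have tr : ∀ f : Pt d n → ℝ≥0∞, Measurable f → ∫⁻ z, f (L z) ∂(Measure.pi fun i => (volume : Measure ℝ).restrict
      (Sum.elim (fun _ => univ) (fun _ => Ico 0 (2*π)) i)) = ∫⁻ z, f z ∂(μP d n) := fun f hf =>
    hmp.lintegral_comp hf
  have hcu := hu.continuous
  have hcX : ∀ i, Continuous (dX d n i u) := fun i =>
    (hu.continuous_fderiv one_ne_zero).clm_apply continuous_const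
  have hcY : ∀ i, Continuous (dY d n i u) := fun i =>
    (hu.continuous_fderiv one_ne_zero).clm_apply continuous_const
  have m1 : Measurable fun z => ENNReal.ofReal (‖u z‖^2) :=
    (ENNReal.continuous_ofReal.comp (by fun_prop)).measurable
  have hMl : ∫⁻ z, ENNReal.ofReal (‖u z‖^2) ∂(μP d n) = ENNReal.ofReal (Mass d n u) :=
    (ofReal_integral_eq_lintegral_ofReal hM (Eventually.of_forall fun _ => by positivity)).symm
  have key := gn_pi (by simp; omega) (Sum.elim (fun _ : Fin d => univ) (fun _ : Fin n => Ico 0 (2*π)))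
    (by rintro (i|i) <;> simp) (by
      rintro (i|i) x hx
      · exact ⟨x, ⟨le_rfl, by linarith⟩, subset_univ _⟩
      · have hx' : x ∈ Ico 0 (2*π) := hx
        have := Real.pi_gt_three
        by_cases h : x + 1 < 2*π
        · exact ⟨x, ⟨le_rfl, by linarith⟩, fun y hy => ⟨by linarith [hx'.1, hy.1], by linarith [hy.2]⟩⟩
        · exact ⟨x-1, ⟨by linarith, by linarith⟩, fun y hy => ⟨by linarith [hy.1], by linarith [hy.2, hx'.2]⟩⟩)
    (fun z => u (L z)) hu2 (by rw [tr _ m1, hMl]; exact ENNReal.ofReal_ne_top)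
  have fX : ∀ i z, fderiv ℝ u z (Pi.single i 1, 0) = dX d n i u z := fun _ _ => rfl
  have fY : ∀ i z, fderiv ℝ u z (0, Pi.single i 1) = dY d n i u z := fun _ _ => rfl
  simp only [hfd, Fintype.sum_sum_type, hLl, hLr, fX, fY] at key
  rw [hcard, tr _ m1, tr _ (m1.pow_const _), tr (fun z => (ENNReal.ofReal (‖u z‖ + (∑ i, ‖dX d n i u z‖
      + ∑ j, ‖dY d n j u z‖))) ^ (2:ℝ)) (by
        apply Measurable.pow_const
        exact (ENNReal.continuous_ofReal.comp (by fun_prop)).measurable), hMl] at key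
  have hH : ∫⁻ z, (ENNReal.ofReal (‖u z‖ + (∑ i, ‖dX d n i u z‖
      + ∑ j, ‖dY d n j u z‖))) ^ (2:ℝ) ∂(μP d n) ≤
      ENNReal.ofReal ((D+1) * (Mass d n u + gradXSq d n u + gradYSq d n u)) := by
    have hIntg : Integrable (fun z => (D+1) * (‖u z‖^2 + (∑ i, ‖dX d n i u z‖^2)
        + ∑ j, ‖dY d n j u z‖^2)) (μP d n) := ((hM.add hX).add hY).const_mul _
    have e : (D+1) * (Mass d n u + gradXSq d n u + gradYSq d n u) =
        ∫ z, (D+1) * (‖u z‖^2 + (∑ i, ‖dX d n i u z‖^2)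
        + ∑ j, ‖dY d n j u z‖^2) ∂(μP d n) := by
      rw [integral_const_mul, integral_add (f := fun z => ‖u z‖^2 + ∑ i, ‖dX d n i u z‖^2) (hM.add hX) hY, integral_add hM hX]
      rfl
    rw [e, ofReal_integral_eq_lintegral_ofReal hIntg (Eventually.of_forall fun z => by
      have : 0 ≤ D + 1 := by linarith
      positivity)]
    apply lintegral_mono
    intro z
    beta_reduce
    rw [ENNReal.ofReal_rpow_of_nonneg (by positivity) (by norm_num)]
    apply ENNReal.ofReal_le_ofReal
    have := sq_sum_le_card_mul_sum_sq (s := (Finset.univ : Finset (Option (Fin d ⊕ Fin n))))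
      (f := fun o => Option.elim o ‖u z‖ (Sum.elim (fun i => ‖dX d n i u z‖) (fun j => ‖dY d n j u z‖)))
    simp only [Fintype.sum_option, Fintype.sum_sum_type, Option.elim, Sum.elim_inl, Sum.elim_inr,
      Finset.card_univ, Fintype.card_option, Fintype.card_sum, Fintype.card_fin] at this
    push_cast at this
    rw [Real.rpow_two, hD, add_assoc (‖u z‖^2)]
    exact this
  have hM0 : 0 ≤ Mass d n u := integral_nonneg fun _ => by positivity
  have hX0 : 0 ≤ gradXSq d n u := integral_nonneg fun _ => by positivity
  have hY0 : 0 ≤ gradYSq d n u := integral_nonneg fun _ => by positivity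
  have hp : ∀ z, ENNReal.ofReal (‖u z‖^2) ^ (1 + 2 / D) = ENNReal.ofReal (‖u z‖ ^ (2 + 4/D)) := by
    intro z
    rw [ENNReal.ofReal_rpow_of_nonneg (by positivity) (by positivity), ← Real.rpow_two,
      ← Real.rpow_mul (norm_nonneg _)]
    congr 2
    ring
  simp only [hp] at key
  set B := 9 * (D+1) * Mass d n u ^ (2 / D) *
      (Mass d n u + gradXSq d n u + gradYSq d n u) with hB
  have hB0 : 0 ≤ B := by positivity
  have fin : ∫⁻ z, ENNReal.ofReal (‖u z‖ ^ (2 + 4/D)) ∂(μP d n) ≤ ENNReal.ofReal B := by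
    refine key.trans ?_
    calc _ ≤ (ENNReal.ofReal (Mass d n u) ^ (1/D) * (ENNReal.ofReal 3 *
          ENNReal.ofReal ((D+1) * (Mass d n u + gradXSq d n u + gradYSq d n u)) ^ (1/2:ℝ))) ^ 2 := by
            gcongr
      _ = ENNReal.ofReal B := by
        rw [ENNReal.ofReal_rpow_of_nonneg hM0 (by positivity),
          ENNReal.ofReal_rpow_of_nonneg (by positivity) (by positivity),
          ← ENNReal.ofReal_mul (by norm_num), ← ENNReal.ofReal_mul (by positivity),
          ← ENNReal.ofReal_pow (by positivity)]
        congr 1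
        rw [mul_pow, mul_pow, ← Real.sqrt_eq_rpow, Real.sq_sqrt (by positivity), hB,
          ← Real.rpow_mul_natCast hM0, show 1 / D * ((2:ℕ):ℝ) = 2 / D by push_cast; ring]
        ring
  have hcp : Continuous fun z => ‖u z‖ ^ (2 + 4/D) :=
    (by fun_prop : Continuous fun z => ‖u z‖).rpow_const fun _ => Or.inr (by positivity)
  have hIntg : Integrable (fun z => ‖u z‖ ^ (2 + 4/D)) (μP d n) := by
    refine ⟨hcp.aestronglyMeasurable, ?_⟩
    rw [hasFiniteIntegral_iff_ofReal (Eventually.of_forall fun _ => by positivity)]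
    exact fin.trans_lt ENNReal.ofReal_lt_top
  refine ⟨hIntg, ?_⟩
  rw [← ofReal_integral_eq_lintegral_ofReal hIntg (Eventually.of_forall fun _ => by positivity)] at fin
  exact (ENNReal.ofReal_le_ofReal_iff hB0).1 fin

end BNLS

end

section
open MeasureTheory Real Filter Set
open scoped ENNReal Topology

namespace BNLS

lemma half_path {n : ℕ} (f : (Fin n → ℝ) → ℂ) (hf : ContDiff ℝ 1 f) (y w : Fin n → ℝ)
    (hw : ∀ j, |w j| ≤ 2*π) :
    ‖f (y + (1/2:ℝ) • w) - f y‖^2 ≤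
      ∫ t in (0:ℝ)..(1/2), (2*π)^2 * n * ∑ j, ‖fderiv ℝ f (y + t • w) (Pi.single j 1)‖^2 := by
  have hz : ∀ t : ℝ, HasDerivAt (fun t : ℝ => f (y + t • w)) (fderiv ℝ f (y + t • w) w) t := by
    intro t
    have h1 : HasDerivAt (fun t : ℝ => y + t • w) w t := by
      simpa using ((hasDerivAt_id t).smul_const w).const_add y
    exact ((hf.differentiable one_ne_zero) _).hasFDerivAt.comp_hasDerivAt t h1
  have hpath : Continuous fun t : ℝ => y + t • w := by fun_prop
  have hfd : Continuous fun t : ℝ => fderiv ℝ f (y + t • w) :=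
    (hf.continuous_fderiv one_ne_zero).comp hpath
  have hgc : Continuous fun t : ℝ => fderiv ℝ f (y + t • w) w := hfd.clm_apply continuous_const
  have hIntg : f (y + (1/2:ℝ) • w) - f y = ∫ t in (0:ℝ)..(1/2), fderiv ℝ f (y + t • w) w := by
    rw [intervalIntegral.integral_eq_sub_of_hasDerivAt (fun t _ => hz t) (hgc.intervalIntegrable _ _)]
    simp
  set g : ℝ → ℝ := fun t => ‖fderiv ℝ f (y + t • w) w‖ with hg
  have hgc' : Continuous g := hgc.norm
  set Iv := ∫ t in (0:ℝ)..(1/2), g t with hI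
  have hI0 : 0 ≤ Iv := intervalIntegral.integral_nonneg (by norm_num) fun t _ => norm_nonneg _
  have h1 : ‖f (y + (1/2:ℝ) • w) - f y‖ ≤ Iv := by
    rw [hIntg]
    exact intervalIntegral.norm_integral_le_integral_norm (by norm_num)
  have h2 : Iv^2 ≤ ∫ t in (0:ℝ)..(1/2), g t ^ 2 := by
    have hnn : 0 ≤ ∫ t in (0:ℝ)..(1/2), (g t - 2 * Iv)^2 :=
      intervalIntegral.integral_nonneg (by norm_num) fun t _ => sq_nonneg _
    have e : ∫ t in (0:ℝ)..(1/2), (g t - 2 * Iv)^2 =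
        (∫ t in (0:ℝ)..(1/2), g t ^ 2) - 4 * Iv * Iv + 2 * Iv^2 := by
      have : ∀ t, (g t - 2 * Iv)^2 = g t ^ 2 - 4 * Iv * g t + 4 * Iv^2 := fun t => by ring
      simp only [this]
      rw [intervalIntegral.integral_add ((by fun_prop : Continuous fun t => g t ^ 2 - 4 * Iv * g t).intervalIntegrable _ _)
        (continuous_const.intervalIntegrable _ _),
        intervalIntegral.integral_sub ((by fun_prop : Continuous fun t => g t ^ 2).intervalIntegrable _ _)
        ((by fun_prop : Continuous fun t => 4 * Iv * g t).intervalIntegrable _ _),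
        intervalIntegral.integral_const_mul, intervalIntegral.integral_const, ← hI]
      simp only [smul_eq_mul]; ring
    nlinarith
  have hdc : ∀ j : Fin n, Continuous fun t : ℝ => fderiv ℝ f (y + t • w) (Pi.single j 1) :=
    fun j => hfd.clm_apply continuous_const
  calc _ ≤ Iv^2 := by gcongr
    _ ≤ _ := h2
    _ ≤ _ := by
      apply intervalIntegral.integral_mono_on (by norm_num)
        ((by fun_prop : Continuous fun t => g t ^ 2).intervalIntegrable _ _)
        ((by fun_prop : Continuous fun t => (2*π)^2 * n *
          ∑ j, ‖fderiv ℝ f (y + t • w) (Pi.single j 1)‖^2).intervalIntegrable _ _)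
      intro t _
      have hb : g t ≤ 2*π * ∑ j, ‖fderiv ℝ f (y + t • w) (Pi.single j 1)‖ := by
        have : w = ∑ j, w j • (Pi.single j 1 : Fin n → ℝ) := pi_eq_sum_univ' w
        simp only [hg]
        generalize fderiv ℝ f (y + t • w) = L
        conv_lhs => rw [this, map_sum]
        refine (norm_sum_le _ _).trans ?_
        rw [Finset.mul_sum]
        apply Finset.sum_le_sum
        intro j _
        rw [map_smul, norm_smul]
        gcongr
        exact hw j
      have hs := sq_sum_le_card_mul_sum_sq (s := (Finset.univ : Finset (Fin n)))
        (f := fun j => ‖fderiv ℝ f (y + t • w) (Pi.single j 1)‖)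
      simp only [Finset.card_univ, Fintype.card_fin] at hs
      calc g t ^ 2 ≤ (2*π * ∑ j, ‖fderiv ℝ f (y + t • w) (Pi.single j 1)‖)^2 := by
            gcongr
        _ = (2*π)^2 * (∑ j, ‖fderiv ℝ f (y + t • w) (Pi.single j 1)‖)^2 := by ring
        _ ≤ (2*π)^2 * (n * ∑ j, ‖fderiv ℝ f (y + t • w) (Pi.single j 1)‖^2) := by gcongr
        _ = _ := by ring

lemma torusBox_meas (n : ℕ) : MeasurableSet (torusBox n) :=
  MeasurableSet.univ_pi fun _ => measurableSet_Ico

lemma torusBox_convex (n : ℕ) : Convex ℝ (torusBox n) := convex_pi fun _ _ => convex_Ico _ _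

lemma μT_univ (n : ℕ) : μT n univ = ENNReal.ofReal ((2*π)^n) := by
  simp [μT, torusBox, Real.volume_pi_Ico, ENNReal.ofReal_pow (by positivity : (0:ℝ) ≤ 2*π)]

instance (n : ℕ) : IsFiniteMeasure (μT n) := ⟨by rw [μT_univ]; exact ENNReal.ofReal_lt_top⟩

/-- Contraction towards a point of the box. -/
lemma contract {n : ℕ} (Φ : (Fin n → ℝ) → ℝ≥0∞) (hΦ : Measurable Φ) (y' : Fin n → ℝ)
    (hy' : y' ∈ torusBox n) (t : ℝ) (ht : t ∈ Ioc (0:ℝ) (1/2)) :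
    ∫⁻ y, Φ (y + t • (y' - y)) ∂(μT n) ≤ ENNReal.ofReal (2^n) * ∫⁻ y, Φ y ∂(μT n) := by
  set Ψ := (torusBox n).indicator Φ with hΨ
  have hΨm : Measurable Ψ := hΦ.indicator (torusBox_meas n)
  have ht1 : 0 < 1 - t := by linarith [ht.2]
  calc ∫⁻ y, Φ (y + t • (y' - y)) ∂(μT n) ≤ ∫⁻ y, Ψ ((1 - t) • y + t • y') ∂(μT n) := by
        apply lintegral_mono_ae
        rw [μT]
        filter_upwards [ae_restrict_mem (torusBox_meas n)] with y hy
        have e : y + t • (y' - y) = (1-t) • y + t • y' := by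
          rw [smul_sub, sub_smul, one_smul]; abel
        rw [e, hΨ, indicator_of_mem]
        exact torusBox_convex n hy hy' ht1.le ht.1.le (by ring)
    _ ≤ ∫⁻ y, Ψ ((1 - t) • y + t • y') := lintegral_mono' Measure.restrict_le_self le_rfl
    _ = ENNReal.ofReal |((1-t) ^ n)⁻¹| * ∫⁻ y, Ψ (y + t • y') := by
        have hm := Measure.map_addHaar_smul (volume : Measure (Fin n → ℝ)) ht1.ne'
        have := lintegral_map (μ := (volume : Measure (Fin n → ℝ))) (f := fun y => Ψ (y + t • y'))
          (g := fun y => (1-t) • y) (hΨm.comp (measurable_add_const _)) (measurable_const_smul _)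
        rw [← this, hm, lintegral_smul_measure]
        simp
    _ = ENNReal.ofReal |((1-t) ^ n)⁻¹| * ∫⁻ y, Ψ y := by
        rw [lintegral_add_right_eq_self Ψ (t • y')]
    _ = ENNReal.ofReal |((1-t) ^ n)⁻¹| * ∫⁻ y, Φ y ∂(μT n) := by
        rw [hΨ, lintegral_indicator (torusBox_meas n)]; rfl
    _ ≤ _ := by
        gcongr
        rw [abs_of_pos (by positivity), ← inv_pow]
        gcongr
        rw [inv_le_comm₀ ht1 (by norm_num)]
        linarith [ht.2]

end BNLS

end

section
open MeasureTheory Real Filter Set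
open scoped ENNReal Topology

namespace BNLS

noncomputable def segInt {n : ℕ} (Φ : (Fin n → ℝ) → ℝ≥0∞) (y' y : Fin n → ℝ) : ℝ≥0∞ :=
  ∫⁻ t in Ioc (0:ℝ) (1/2), Φ (y + t • (y' - y))

lemma segInt_meas {n : ℕ} (Φ : (Fin n → ℝ) → ℝ≥0∞) (hΦc : Continuous Φ) :
    Measurable fun p : (Fin n → ℝ) × (Fin n → ℝ) => segInt Φ p.1 p.2 := by
  have hjoint : Measurable fun p : ((Fin n → ℝ) × (Fin n → ℝ)) × ℝ =>
      Φ (p.1.2 + p.2 • (p.1.1 - p.1.2)) := (hΦc.comp (by fun_prop)).measurable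
  exact hjoint.lintegral_prod_right'

lemma segInt_half {n : ℕ} (f : (Fin n → ℝ) → ℂ) (hf : ContDiff ℝ 1 f) 
    (Φ : (Fin n → ℝ) → ℝ≥0∞)
    (hΦ : ∀ y, Φ y = ENNReal.ofReal (∑ j, ‖fderiv ℝ f y (Pi.single j 1)‖^2))
    (y y' : Fin n → ℝ) (hy : y ∈ torusBox n) (hy' : y' ∈ torusBox n) :
    ENNReal.ofReal (2 * ‖f (y + (1/2:ℝ) • (y'-y)) - f y‖^2) ≤
      ENNReal.ofReal (2 * ((2*π)^2 * n)) * segInt Φ y' y := by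
  have hdc : ∀ j : Fin n, Continuous fun z => fderiv ℝ f z (Pi.single j 1) :=
    fun j => (hf.continuous_fderiv one_ne_zero).clm_apply continuous_const
  have hw : ∀ j, |(y' - y) j| ≤ 2*π := by
    intro j
    have a := hy j (mem_univ _); have b := hy' j (mem_univ _)
    simp only [mem_Ico] at a b
    rw [Pi.sub_apply, abs_le]; constructor <;> linarith [a.1, a.2, b.1, b.2]
  have h := half_path f hf y (y'-y) hw
  have hcc : Continuous fun t : ℝ => (2*π)^2 * n *
      ∑ j, ‖fderiv ℝ f (y + t • (y'-y)) (Pi.single j 1)‖^2 := by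
    have : ∀ j, Continuous fun t : ℝ => fderiv ℝ f (y + t • (y'-y)) (Pi.single j 1) := fun j =>
      (hdc j).comp (by fun_prop : Continuous fun t : ℝ => y + t • (y'-y))
    fun_prop
  rw [intervalIntegral.integral_of_le (by norm_num)] at h
  have hi : ENNReal.ofReal (∫ t in Ioc (0:ℝ) (1/2), (2*π)^2 * n *
      ∑ j, ‖fderiv ℝ f (y + t • (y'-y)) (Pi.single j 1)‖^2) =
        ENNReal.ofReal ((2*π)^2 * n) * segInt Φ y' y := by
    rw [ofReal_integral_eq_lintegral_ofReal (hcc.integrableOn_Icc.mono_set Ioc_subset_Icc_self)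
      (Eventually.of_forall fun t => by positivity), segInt,
      ← lintegral_const_mul' _ _ ENNReal.ofReal_ne_top]
    apply lintegral_congr
    intro t
    rw [ENNReal.ofReal_mul (by positivity), hΦ]
  rw [ENNReal.ofReal_mul (by norm_num), ENNReal.ofReal_mul (by norm_num), mul_assoc, ← hi]
  gcongr

lemma segInt_pt {n : ℕ} (f : (Fin n → ℝ) → ℂ) (hf : ContDiff ℝ 1 f) 
    (Φ : (Fin n → ℝ) → ℝ≥0∞)
    (hΦ : ∀ y, Φ y = ENNReal.ofReal (∑ j, ‖fderiv ℝ f y (Pi.single j 1)‖^2))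
    (y y' : Fin n → ℝ) (hy : y ∈ torusBox n) (hy' : y' ∈ torusBox n) :
    ENNReal.ofReal (‖f y - f y'‖^2) ≤ ENNReal.ofReal (2 * ((2*π)^2 * n)) * segInt Φ y' y
      + ENNReal.ofReal (2 * ((2*π)^2 * n)) * segInt Φ y y' := by
  refine le_trans ?_ (add_le_add (segInt_half f hf Φ hΦ y y' hy hy')
    (segInt_half f hf Φ hΦ y' y hy' hy))
  rw [← ENNReal.ofReal_add (by positivity) (by positivity)]
  apply ENNReal.ofReal_le_ofReal
  have e : y' + (1/2:ℝ) • (y - y') = y + (1/2:ℝ) • (y' - y) := by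
    ext j; simp; ring
  rw [e]
  generalize f (y + (1/2:ℝ) • (y' - y)) = m
  have h1 : ‖f y - f y'‖ ≤ ‖m - f y‖ + ‖m - f y'‖ := by
    rw [show f y - f y' = (m - f y') - (m - f y) by ring]
    exact (norm_sub_le _ _).trans (by linarith)
  nlinarith [norm_nonneg (f y - f y'), sq_nonneg (‖m - f y‖ - ‖m - f y'‖)]

lemma segInt_int {n : ℕ} (Φ : (Fin n → ℝ) → ℝ≥0∞) (hΦc : Continuous Φ) :
    ∫⁻ y', ∫⁻ y, segInt Φ y' y ∂(μT n) ∂(μT n) ≤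
      ENNReal.ofReal (2^n * (2*π)^n) * ∫⁻ y, Φ y ∂(μT n) := by
  have hbox : ∀ᵐ y ∂(μT n), y ∈ torusBox n := ae_restrict_mem (torusBox_meas n)
  have : ∀ᵐ y' ∂(μT n), ∫⁻ y, segInt Φ y' y ∂(μT n) ≤ ENNReal.ofReal (2^n) * ∫⁻ y, Φ y ∂(μT n) := by
    filter_upwards [hbox] with y' hy'
    simp only [segInt]
    rw [lintegral_lintegral_swap]
    · calc _ ≤ ∫⁻ t in Ioc (0:ℝ) (1/2), ENNReal.ofReal (2^n) * ∫⁻ y, Φ y ∂(μT n) := by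
            apply lintegral_mono_ae
            filter_upwards [ae_restrict_mem measurableSet_Ioc] with t ht
            exact contract Φ hΦc.measurable y' hy' t ht
        _ ≤ _ := by
            rw [lintegral_const, Measure.restrict_apply_univ, Real.volume_Ioc]
            calc _ ≤ ENNReal.ofReal (2^n) * (∫⁻ y, Φ y ∂(μT n)) * 1 := by
                  gcongr; rw [← ENNReal.ofReal_one]; exact ENNReal.ofReal_le_ofReal (by norm_num)
              _ = _ := mul_one _
    · exact (hΦc.comp (by fun_prop : Continuous fun p : (Fin n → ℝ) × ℝ =>
        p.1 + p.2 • (y' - p.1))).measurable.aemeasurable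
  refine (lintegral_mono_ae this).trans (le_of_eq ?_)
  rw [lintegral_const, μT_univ, ENNReal.ofReal_mul (by positivity)]
  ring

lemma dbl_int {n : ℕ} (μ : Measure (Fin n → ℝ)) [IsFiniteMeasure μ]
    (F : (Fin n → ℝ) → (Fin n → ℝ) → ℝ≥0∞) (T : (Fin n → ℝ) → (Fin n → ℝ) → ℝ≥0∞)
    (hTm : Measurable fun p : (Fin n → ℝ) × (Fin n → ℝ) => T p.1 p.2) (s : Set (Fin n → ℝ))
    (hs : ∀ᵐ y ∂μ, y ∈ s) (c : ℝ≥0∞) (hc : c ≠ ⊤)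
    (hF : ∀ y y', y ∈ s → y' ∈ s → F y' y ≤ c * T y' y + c * T y y') :
    ∫⁻ y', ∫⁻ y, F y' y ∂μ ∂μ ≤ (2 * c) * ∫⁻ y', ∫⁻ y, T y' y ∂μ ∂μ := by
  have hTm1 : ∀ y', Measurable fun y => T y' y := fun y' => hTm.comp measurable_prodMk_left
  calc _ ≤ ∫⁻ y', ∫⁻ y, (c * T y' y + c * T y y') ∂μ ∂μ := by
        apply lintegral_mono_ae
        filter_upwards [hs] with y' hy'
        apply lintegral_mono_ae
        filter_upwards [hs] with y hy
        exact hF y y' hy hy'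
    _ = ∫⁻ y', (c * ∫⁻ y, T y' y ∂μ) + (c * ∫⁻ y, T y y' ∂μ) ∂μ := by
        apply lintegral_congr
        intro y'
        rw [lintegral_add_left ((hTm1 y').const_mul _), lintegral_const_mul' _ _ hc,
          lintegral_const_mul' _ _ hc]
    _ = c * ∫⁻ y', ∫⁻ y, T y' y ∂μ ∂μ + c * ∫⁻ y', ∫⁻ y, T y y' ∂μ ∂μ := by
        rw [lintegral_add_left, lintegral_const_mul' _ _ hc, lintegral_const_mul' _ _ hc]
        exact (hTm.lintegral_prod_right').const_mul _
    _ = c * ∫⁻ y', ∫⁻ y, T y' y ∂μ ∂μ + c * ∫⁻ y', ∫⁻ y, T y' y ∂μ ∂μ := by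
        congr 2
        exact lintegral_lintegral_swap (hTm.comp measurable_swap).aemeasurable
    _ = _ := by ring

lemma poincare_fix {n : ℕ} (f : (Fin n → ℝ) → ℂ) (hf : ContDiff ℝ 1 f) :
    ∫⁻ y', ∫⁻ y, ENNReal.ofReal (‖f y - f y'‖^2) ∂(μT n) ∂(μT n) ≤
      ENNReal.ofReal (4 * ((2*π)^2 * n) * (2^n * (2*π)^n)) *
        ∫⁻ y, ENNReal.ofReal (∑ j, ‖fderiv ℝ f y (Pi.single j 1)‖^2) ∂(μT n) := by
  have hdc : ∀ j : Fin n, Continuous fun z => fderiv ℝ f z (Pi.single j 1) :=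
    fun j => (hf.continuous_fderiv one_ne_zero).clm_apply continuous_const
  have hΦc : Continuous fun y => ENNReal.ofReal (∑ j, ‖fderiv ℝ f y (Pi.single j 1)‖^2) :=
    ENNReal.continuous_ofReal.comp (by fun_prop)
  have hbox : ∀ᵐ y ∂(μT n), y ∈ torusBox n := ae_restrict_mem (torusBox_meas n)
  refine (dbl_int (μT n) (fun y' y => ENNReal.ofReal (‖f y - f y'‖^2)) (segInt _)
    (segInt_meas _ hΦc) (torusBox n) hbox _ ENNReal.ofReal_ne_top
    (fun y y' hy hy' => segInt_pt f hf _ (fun _ => rfl) y y' hy hy')).trans ?_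
  refine (mul_le_mul_right (segInt_int _ hΦc) _).trans (le_of_eq ?_)
  rw [← mul_assoc]
  congr 1
  rw [show (2:ℝ≥0∞) = ENNReal.ofReal 2 by simp, ← ENNReal.ofReal_mul (by norm_num), ← ENNReal.ofReal_mul (by positivity)]
  congr 1; ring

end BNLS

end

section
open MeasureTheory Real Filter Set
open scoped ENNReal Topology

namespace BNLS

instance (d n : ℕ) : SFinite (μP d n) := by unfold μP; infer_instance

lemma interp_pt (p q R s : ℝ) (hp : 2 < p) (hpq : p < q) (hR : 0 < R) (hs : 0 ≤ s) :
    s^p ≤ R^(p-q) * s^q + R^(p-2) * s^2 := by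
  rcases hs.eq_or_lt with rfl | hs
  · rw [Real.zero_rpow (by linarith), Real.zero_rpow (by linarith)]; simp
  rcases le_total R s with h | h
  · have : s^p = s^(p-q) * s^q := by rw [← Real.rpow_add hs]; ring_nf
    have h2 : s^(p-q) ≤ R^(p-q) := Real.rpow_le_rpow_of_nonpos hR h (by linarith)
    have h3 : s^p ≤ R^(p-q) * s^q := by rw [this]; gcongr
    have : 0 ≤ R^(p-2) * s^2 := by positivity
    linarith
  · have : s^p = s^(p-2) * s^2 := by
      rw [← Real.rpow_natCast s 2, ← Real.rpow_add hs]; norm_num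
    have h2 : s^(p-2) ≤ R^(p-2) := Real.rpow_le_rpow hs.le h (by linarith)
    have h3 : s^p ≤ R^(p-2) * s^2 := by rw [this]; gcongr
    have : 0 ≤ R^(p-q) * s^q := by positivity
    linarith

lemma exists_R (p q K : ℝ) (hpq : p < q) (hK : 0 < K) : ∃ R : ℝ, 0 < R ∧ R^(p-q) ≤ K := by
  refine ⟨K^(1/(p-q)), by positivity, ?_⟩
  rw [← Real.rpow_mul hK.le, one_div, inv_mul_cancel₀ (by linarith), Real.rpow_one]

/-- C¹ with finite first-order norms. -/
structure Reg (d n : ℕ) (u : Pt d n → ℂ) : Prop where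
  c1 : ContDiff ℝ 1 u
  M : Integrable (fun z => ‖u z‖^2) (μP d n)
  X : Integrable (fun z => ∑ i, ‖dX d n i u z‖^2) (μP d n)
  Y : Integrable (fun z => ∑ j, ‖dY d n j u z‖^2) (μP d n)

lemma dX_cont {d n : ℕ} {u : Pt d n → ℂ} (hu : ContDiff ℝ 1 u) (i : Fin d) :
    Continuous (dX d n i u) :=
  (hu.continuous_fderiv one_ne_zero).clm_apply continuous_const

lemma dY_cont {d n : ℕ} {u : Pt d n → ℂ} (hu : ContDiff ℝ 1 u) (j : Fin n) :
    Continuous (dY d n j u) :=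
  (hu.continuous_fderiv one_ne_zero).clm_apply continuous_const

lemma InH2.reg {d n : ℕ} {u : Pt d n → ℂ} (hu : InH2 d n u) : Reg d n u := by
  obtain ⟨h2, _, hM, hG, _⟩ := hu
  have h1 : ContDiff ℝ 1 u := h2.of_le (by norm_num)
  have a := dX_cont h1
  have b := dY_cont h1
  refine ⟨h1, hM, ?_, ?_⟩
  · refine hG.mono' (by fun_prop : Continuous fun z => ∑ i, ‖dX d n i u z‖^2).aestronglyMeasurable
      (Eventually.of_forall fun z => ?_)
    rw [Real.norm_of_nonneg (by positivity)]
    exact le_add_of_nonneg_right (by positivity)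
  · refine hG.mono' (by fun_prop : Continuous fun z => ∑ i, ‖dY d n i u z‖^2).aestronglyMeasurable
      (Eventually.of_forall fun z => ?_)
    rw [Real.norm_of_nonneg (by positivity)]
    exact le_add_of_nonneg_left (by positivity)

lemma gradXSq_nonneg (d n : ℕ) (u : Pt d n → ℂ) : 0 ≤ gradXSq d n u :=
  integral_nonneg fun z => by positivity
lemma gradYSq_nonneg (d n : ℕ) (u : Pt d n → ℂ) : 0 ≤ gradYSq d n u :=
  integral_nonneg fun z => by positivity
lemma lapXSq_nonneg (d n : ℕ) (u : Pt d n → ℂ) : 0 ≤ lapXSq d n u :=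
  integral_nonneg fun z => by positivity
lemma lapYSq_nonneg (d n : ℕ) (u : Pt d n → ℂ) : 0 ≤ lapYSq d n u :=
  integral_nonneg fun z => by positivity
lemma Mass_nonneg (d n : ℕ) (u : Pt d n → ℂ) : 0 ≤ Mass d n u :=
  integral_nonneg fun z => by positivity
lemma Npow_nonneg (d n : ℕ) (p : ℝ) (u : Pt d n → ℂ) : 0 ≤ Npow d n p u :=
  integral_nonneg fun z => by positivity

lemma Npow_bound {d n : ℕ} (hd : 1 ≤ d) (hn : 1 ≤ n) (p R : ℝ) (hp : 2 < p)
    (hpq : p < 2 + 4/((d:ℝ)+n)) (hR : 0 < R) {u : Pt d n → ℂ} (hu : Reg d n u) :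
    Integrable (fun z => ‖u z‖^p) (μP d n) ∧
    Npow d n p u ≤ R^(p-(2 + 4/((d:ℝ)+n))) * (9*((d:ℝ)+n+1) * Mass d n u ^ (2/((d:ℝ)+n)) *
      (Mass d n u + gradXSq d n u + gradYSq d n u)) + R^(p-2) * Mass d n u := by
  obtain ⟨hI, hN⟩ := gn_Pt d n hd hn u hu.c1 hu.M hu.X hu.Y
  set q := 2 + 4/((d:ℝ)+n) with hq
  have hsum : Integrable (fun z => R^(p-q) * ‖u z‖^q + R^(p-2) * ‖u z‖^2) (μP d n) :=
    (hI.const_mul _).add (hu.M.const_mul _)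
  have hpt : ∀ z, ‖u z‖^p ≤ R^(p-q) * ‖u z‖^q + R^(p-2) * ‖u z‖^2 := fun z =>
    interp_pt p q R _ hp hpq hR (norm_nonneg _)
  have hc : Continuous fun z => ‖u z‖^p :=
    hu.c1.continuous.norm.rpow_const fun _ => Or.inr (by linarith)
  have hIntg : Integrable (fun z => ‖u z‖^p) (μP d n) := by
    refine hsum.mono' hc.aestronglyMeasurable (Eventually.of_forall fun z => ?_)
    rw [Real.norm_of_nonneg (by positivity)]
    exact hpt z
  refine ⟨hIntg, ?_⟩
  calc Npow d n p u ≤ ∫ z, (R^(p-q) * ‖u z‖^q + R^(p-2) * ‖u z‖^2) ∂(μP d n) :=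
        integral_mono hIntg hsum hpt
    _ = R^(p-q) * Npow d n q u + R^(p-2) * Mass d n u := by
        rw [integral_add (hI.const_mul _) (hu.M.const_mul _), integral_const_mul, integral_const_mul]
        rfl
    _ ≤ _ := by gcongr

lemma coercive (d n : ℕ) (hd : 1 ≤ d) (hn : 1 ≤ n) (β α : ℝ)
    (hβ : 0 < β) (hα : 0 < α) (hα' : α < 4 / ((d:ℝ)+n)) :
    ∃ C1 : ℝ, 0 ≤ C1 ∧ ∀ u ∈ Sset d n 1, ∀ τ : ℝ, 1 ≤ τ →
      (β/4) * (gradXSq d n u + τ * gradYSq d n u) - C1 ≤ Etau d n τ β α u := by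
  obtain ⟨R, hR, hRK⟩ := exists_R (α+2) (2 + 4/((d:ℝ)+n)) (β/4/(9*((d:ℝ)+n+1)))
    (by linarith) (by positivity)
  refine ⟨β/4 + R^(α+2-2), by positivity, ?_⟩
  intro u hu τ hτ
  have hN := (Npow_bound hd hn (α+2) R (by linarith) (by linarith) hR hu.1.reg).2
  rw [hu.2, Real.one_rpow] at hN
  have h1 := gradXSq_nonneg d n u
  have h2 := gradYSq_nonneg d n u
  have h3 := lapXSq_nonneg d n u
  have h4 := lapYSq_nonneg d n u
  have h5 := Npow_nonneg d n (α+2) u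
  rw [le_div_iff₀ (by positivity)] at hRK
  have h6 : (1/(α+2)) * Npow d n (α+2) u ≤ Npow d n (α+2) u := by
    have : 1/(α+2) ≤ 1 := by rw [div_le_one (by linarith)]; linarith
    nlinarith
  have h7 : R^(α+2-(2 + 4/((d:ℝ)+n))) * (9*((d:ℝ)+n+1) * 1 *
      (1 + gradXSq d n u + gradYSq d n u)) ≤ β/4 * (1 + gradXSq d n u + gradYSq d n u) := by
    calc _ = R^(α+2-(2 + 4/((d:ℝ)+n))) * (9*((d:ℝ)+n+1)) * (1 + gradXSq d n u + gradYSq d n u) := by ring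
      _ ≤ _ := by gcongr
  have h8 : gradYSq d n u ≤ τ * gradYSq d n u := by nlinarith
  have h9 : 0 ≤ 1/(2*τ) * lapXSq d n u := by positivity
  have h10 : 0 ≤ τ/2 * lapYSq d n u := by positivity
  unfold Etau
  nlinarith

end BNLS

end

section
open MeasureTheory Real Filter Set
open scoped ENNReal Topology

namespace BNLS

/-- Cylinder extension. -/
def cyl (d n : ℕ) (v : (Fin d → ℝ) → ℂ) : Pt d n → ℂ := fun z => v z.1

lemma dXd_cd {d : ℕ} {v : (Fin d → ℝ) → ℂ} (hv : ContDiff ℝ 2 v) (i : Fin d) :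
    ContDiff ℝ 1 (dXd d i v) :=
  (hv.fderiv_right (by norm_num)).clm_apply contDiff_const

lemma dX_cd {d n : ℕ} {v : Pt d n → ℂ} (hv : ContDiff ℝ 2 v) (i : Fin d) :
    ContDiff ℝ 1 (dX d n i v) :=
  (hv.fderiv_right (by norm_num)).clm_apply contDiff_const

lemma dY_cd {d n : ℕ} {v : Pt d n → ℂ} (hv : ContDiff ℝ 2 v) (i : Fin n) :
    ContDiff ℝ 1 (dY d n i v) :=
  (hv.fderiv_right (by norm_num)).clm_apply contDiff_const

lemma dXd_cont {d : ℕ} {v : (Fin d → ℝ) → ℂ} (hv : ContDiff ℝ 1 v) (i : Fin d) :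
    Continuous (dXd d i v) :=
  (hv.continuous_fderiv one_ne_zero).clm_apply continuous_const

lemma cyl_fderiv {d n : ℕ} {v : (Fin d → ℝ) → ℂ} (hv : ContDiff ℝ 1 v) (z h : Pt d n) :
    fderiv ℝ (cyl d n v) z h = fderiv ℝ v z.1 h.1 := by
  have h1 : HasFDerivAt (cyl d n v) ((fderiv ℝ v z.1).comp (ContinuousLinearMap.fst ℝ _ _)) z :=
    ((hv.differentiable one_ne_zero) z.1).hasFDerivAt.comp z hasFDerivAt_fst
  rw [h1.fderiv]; rfl

lemma dX_cyl {d n : ℕ} {v : (Fin d → ℝ) → ℂ} (hv : ContDiff ℝ 1 v) (i : Fin d) :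
    dX d n i (cyl d n v) = cyl d n (dXd d i v) := by
  ext z; simp only [dX, cyl_fderiv hv]; rfl

lemma dY_cyl {d n : ℕ} {v : (Fin d → ℝ) → ℂ} (hv : ContDiff ℝ 1 v) (j : Fin n) :
    dY d n j (cyl d n v) = 0 := by
  ext z; simp [dY, cyl_fderiv hv]

lemma dX_zero (d n : ℕ) (i : Fin d) : dX d n i 0 = 0 := by
  ext z; simp [dX]
lemma dY_zero (d n : ℕ) (i : Fin n) : dY d n i 0 = 0 := by
  ext z; simp [dY]

lemma int_fst (d n : ℕ) (g : (Fin d → ℝ) → ℝ) :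
    ∫ z, g z.1 ∂(μP d n) = (2*π)^n * ∫ x, g x := by
  rw [μP, integral_fun_fst, Measure.real, μT_univ, ENNReal.toReal_ofReal (by positivity), smul_eq_mul]

lemma integrable_fst {d n : ℕ} {g : (Fin d → ℝ) → ℝ} (hg : Integrable g) :
    Integrable (fun z : Pt d n => g z.1) (μP d n) := hg.comp_fst (μT n)

lemma cyl_InH2 {d n : ℕ} {v : (Fin d → ℝ) → ℂ} (hv : InH2d d v) : InH2 d n (cyl d n v) := by
  obtain ⟨h2, hM, hX, hH⟩ := hv
  have h1 : ContDiff ℝ 1 v := h2.of_le (by norm_num)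
  refine ⟨h2.comp contDiff_fst, fun j p => rfl, integrable_fst hM, ?_, ?_⟩
  · simp only [dX_cyl h1, dY_cyl h1, Pi.zero_apply, norm_zero]
    simpa [cyl] using integrable_fst (n := n) hX
  · have : hessInt d n (cyl d n v) = fun z => ∑ i, ∑ i', ‖dXd d i (dXd d i' v) z.1‖^2 := by
      ext z
      unfold hessInt
      simp only [dX_cyl h1, dY_cyl h1, dX_cyl (dXd_cd h2 _), dY_cyl (dXd_cd h2 _), dX_zero, dY_zero,
        Pi.zero_apply, norm_zero]
      simp [cyl]
    rw [this]
    exact integrable_fst hH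

lemma Mass_cyl (d n : ℕ) (v : (Fin d → ℝ) → ℂ) : Mass d n (cyl d n v) = (2*π)^n * Massd d v :=
  int_fst d n fun x => ‖v x‖^2

lemma Npow_cyl (d n : ℕ) (p : ℝ) (v : (Fin d → ℝ) → ℂ) :
    Npow d n p (cyl d n v) = (2*π)^n * Npowd d p v :=
  int_fst d n fun x => ‖v x‖^p

lemma gradXSq_cyl {d n : ℕ} {v : (Fin d → ℝ) → ℂ} (h1 : ContDiff ℝ 1 v) :
    gradXSq d n (cyl d n v) = (2*π)^n * gradSqd d v := by
  unfold gradXSq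
  simp only [dX_cyl h1]
  exact int_fst d n fun x => ∑ i, ‖dXd d i v x‖^2

lemma gradYSq_cyl {d n : ℕ} {v : (Fin d → ℝ) → ℂ} (h1 : ContDiff ℝ 1 v) :
    gradYSq d n (cyl d n v) = 0 := by
  unfold gradYSq
  simp [dY_cyl h1]

lemma lapYSq_cyl {d n : ℕ} {v : (Fin d → ℝ) → ℂ} (h1 : ContDiff ℝ 1 v) :
    lapYSq d n (cyl d n v) = 0 := by
  unfold lapYSq lapY
  simp [dY_cyl h1, dY_zero]

lemma lapXSq_cyl {d n : ℕ} {v : (Fin d → ℝ) → ℂ} (h2 : ContDiff ℝ 2 v) :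
    lapXSq d n (cyl d n v) = (2*π)^n * lapSqd d v := by
  unfold lapXSq lapX
  simp only [dX_cyl (h2.of_le (by norm_num)), dX_cyl (dXd_cd h2 _)]
  exact int_fst d n fun x => ‖lapd d v x‖^2

lemma Etau_cyl {d n : ℕ} (τ β α : ℝ) {v : (Fin d → ℝ) → ℂ} (h2 : ContDiff ℝ 2 v) :
    Etau d n τ β α (cyl d n v) = (2*π)^n * ((β/2) * gradSqd d v - (1/(α+2)) * Npowd d (α+2) v)
      + (2*π)^n * lapSqd d v / 2 * τ⁻¹ := by
  have h1 : ContDiff ℝ 1 v := h2.of_le (by norm_num)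
  unfold Etau
  rw [lapYSq_cyl h1, gradYSq_cyl h1, lapXSq_cyl h2, gradXSq_cyl h1, Npow_cyl, one_div (2*τ), mul_inv]
  ring

/-! Scaling -/

lemma dXd_smul {d : ℕ} {v : (Fin d → ℝ) → ℂ} (h1 : ContDiff ℝ 1 v) (i : Fin d) (l : ℝ) :
    dXd d i (fun x => l • v x) = fun x => l • dXd d i v x := by
  ext x
  unfold dXd
  rw [fderiv_fun_const_smul ((h1.differentiable one_ne_zero) x)]
  rfl

lemma scale_InH2d {d : ℕ} {v : (Fin d → ℝ) → ℂ} (hv : InH2d d v) (l : ℝ) :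
    InH2d d (fun x => l • v x) := by
  obtain ⟨h2, hM, hX, hH⟩ := hv
  have h1 : ContDiff ℝ 1 v := h2.of_le (by norm_num)
  refine ⟨h2.const_smul l, ?_, ?_, ?_⟩
  · simp only [norm_smul, mul_pow]; exact hM.const_mul _
  · simp only [dXd_smul h1, norm_smul, mul_pow, ← Finset.mul_sum]; exact hX.const_mul _
  · simp only [dXd_smul h1, dXd_smul (dXd_cd h2 _), norm_smul, mul_pow, ← Finset.mul_sum]
    exact hH.const_mul _

lemma scale_Massd (d : ℕ) (v : (Fin d → ℝ) → ℂ) (l : ℝ) :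
    Massd d (fun x => l • v x) = l^2 * Massd d v := by
  unfold Massd
  simp only [norm_smul, mul_pow, Real.norm_eq_abs, sq_abs, integral_const_mul]

lemma scale_gradSqd {d : ℕ} {v : (Fin d → ℝ) → ℂ} (h1 : ContDiff ℝ 1 v) (l : ℝ) :
    gradSqd d (fun x => l • v x) = l^2 * gradSqd d v := by
  unfold gradSqd
  simp only [dXd_smul h1, norm_smul, mul_pow, Real.norm_eq_abs, sq_abs, ← Finset.mul_sum, integral_const_mul]

lemma scale_Npowd (d : ℕ) (v : (Fin d → ℝ) → ℂ) (p l : ℝ) (hl : 0 ≤ l) :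
    Npowd d p (fun x => l • v x) = l^p * Npowd d p v := by
  unfold Npowd
  simp only [norm_smul, Real.norm_eq_abs, abs_of_nonneg hl, Real.mul_rpow hl (norm_nonneg _),
    integral_const_mul]

/-! Slices -/

lemma slice_fderiv {d n : ℕ} {u : Pt d n → ℂ} (hu : ContDiff ℝ 1 u) (y : Fin n → ℝ) (i : Fin d) :
    dXd d i (fun x => u (x, y)) = fun x => dX d n i u (x, y) := by
  ext x
  have h1 : HasFDerivAt (fun x : Fin d → ℝ => u (x, y))
      ((fderiv ℝ u (x,y)).comp ((ContinuousLinearMap.id ℝ _).prod 0)) x :=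
    ((hu.differentiable one_ne_zero) (x,y)).hasFDerivAt.comp x
      ((hasFDerivAt_id x).prodMk (hasFDerivAt_const y x))
  unfold dXd dX
  rw [h1.fderiv]; rfl

lemma sliceY_fderiv {d n : ℕ} {u : Pt d n → ℂ} (hu : ContDiff ℝ 1 u) (x : Fin d → ℝ) (y : Fin n → ℝ)
    (j : Fin n) :
    fderiv ℝ (fun y => u (x, y)) y (Pi.single j 1) = dY d n j u (x, y) := by
  have h1 : HasFDerivAt (fun y : Fin n → ℝ => u (x, y))
      ((fderiv ℝ u (x,y)).comp ((0 : (Fin n → ℝ) →L[ℝ] (Fin d → ℝ)).prod (ContinuousLinearMap.id ℝ _))) y :=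
    ((hu.differentiable one_ne_zero) (x,y)).hasFDerivAt.comp y
      ((hasFDerivAt_const x y).prodMk (hasFDerivAt_id y))
  unfold dY
  rw [h1.fderiv]; rfl

lemma slice_InH2d {d n : ℕ} {u : Pt d n → ℂ} (hu : InH2 d n u) :
    ∀ᵐ y ∂(μT n), InH2d d (fun x => u (x, y)) := by
  have hr := hu.reg
  have h2 := hu.1
  have hH : Integrable (fun z => ∑ i, ∑ i', ‖dX d n i (dX d n i' u) z‖^2) (μP d n) := by
    have a := fun i i' => dX_cont (dX_cd h2 i') i
    refine hu.2.2.2.2.mono' (by fun_prop : Continuous fun z => ∑ i, ∑ i', ‖dX d n i (dX d n i' u) z‖^2).aestronglyMeasurable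
      (Eventually.of_forall fun z => ?_)
    rw [Real.norm_of_nonneg (by positivity)]
    unfold hessInt
    rw [add_assoc, add_assoc]
    exact le_add_of_nonneg_right (by positivity)
  filter_upwards [hr.M.prod_left_ae, hr.X.prod_left_ae, hH.prod_left_ae] with y a b c
  refine ⟨h2.comp (contDiff_id.prodMk contDiff_const), a, ?_, ?_⟩
  · simpa only [slice_fderiv hr.c1] using b
  · simpa only [slice_fderiv hr.c1, slice_fderiv (dX_cd h2 _)] using c

end BNLS

end

section
open MeasureTheory Real Filter Set
open scoped ENNReal Topology

namespace BNLS

/-- Poincaré constant. -/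
noncomputable def Cp (n : ℕ) : ℝ := 4 * ((2*π)^2 * n) * (2^n * (2*π)^n)

lemma Cp_nonneg (n : ℕ) : 0 ≤ Cp n := by unfold Cp; positivity

lemma poincare_Pt {d n : ℕ} {u : Pt d n → ℂ} (hu : Reg d n u) :
    ∫⁻ y0, ∫⁻ z, ENNReal.ofReal (‖u z - u (z.1, y0)‖^2) ∂(μP d n) ∂(μT n) ≤
      ENNReal.ofReal (Cp n) * ENNReal.ofReal (gradYSq d n u) := by
  have huc := hu.c1.continuous
  have hdc := dY_cont hu.c1
  have e1 : ∀ y0, ∫⁻ z, ENNReal.ofReal (‖u z - u (z.1, y0)‖^2) ∂(μP d n) =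
      ∫⁻ x, ∫⁻ y, ENNReal.ofReal (‖u (x,y) - u (x, y0)‖^2) ∂(μT n) := by
    intro y0
    rw [μP, lintegral_prod]
    have : Continuous fun z : Pt d n => ENNReal.ofReal (‖u z - u (z.1, y0)‖^2) :=
      ENNReal.continuous_ofReal.comp (by fun_prop)
    exact this.measurable.aemeasurable
  simp only [e1]
  have hmeas : Measurable fun q : (Fin n → ℝ) × (Fin d → ℝ) =>
      ∫⁻ y, ENNReal.ofReal (‖u (q.2,y) - u (q.2, q.1)‖^2) ∂(μT n) := by
    have : Continuous fun w : ((Fin n → ℝ) × (Fin d → ℝ)) × (Fin n → ℝ) =>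
        ENNReal.ofReal (‖u (w.1.2,w.2) - u (w.1.2, w.1.1)‖^2) :=
      ENNReal.continuous_ofReal.comp (by fun_prop)
    exact this.measurable.lintegral_prod_right'
  rw [lintegral_lintegral_swap hmeas.aemeasurable]
  have hG : ENNReal.ofReal (gradYSq d n u) =
      ∫⁻ x, ∫⁻ y, ENNReal.ofReal (∑ j, ‖dY d n j u (x,y)‖^2) ∂(μT n) := by
    unfold gradYSq
    rw [ofReal_integral_eq_lintegral_ofReal hu.Y (Eventually.of_forall fun z => by positivity), μP,
      lintegral_prod]
    have : Continuous fun z : Pt d n => ENNReal.ofReal (∑ j, ‖dY d n j u z‖^2) :=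
      ENNReal.continuous_ofReal.comp (by fun_prop)
    exact this.measurable.aemeasurable
  rw [hG, ← lintegral_const_mul' _ _ ENNReal.ofReal_ne_top]
  apply lintegral_mono
  intro x
  have := poincare_fix (fun y => u (x,y)) (hu.c1.comp (contDiff_const.prodMk contDiff_id))
  simp only [sliceY_fderiv hu.c1] at this
  exact this

lemma slice_sel {d n : ℕ} {u : Pt d n → ℂ} (hu : InH2 d n u) (s : ℝ) (hs : 0 < s) :
    ∃ v : (Fin d → ℝ) → ℂ, InH2d d v ∧
      (2*π)^n * gradSqd d v ≤ gradXSq d n u + s * (Cp n * gradYSq d n u) ∧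
      s * ((2*π)^n * Mass d n (fun z => u z - cyl d n v z)) ≤
        gradXSq d n u + s * (Cp n * gradYSq d n u) := by
  have hr := hu.reg
  have huc := hr.c1.continuous
  have hdc := dX_cont hr.c1
  set T1 : (Fin n → ℝ) → ℝ≥0∞ := fun y0 => ∫⁻ x, ENNReal.ofReal (∑ i, ‖dX d n i u (x,y0)‖^2) with hT1
  set T2 : (Fin n → ℝ) → ℝ≥0∞ := fun y0 =>
    ∫⁻ z, ENNReal.ofReal (‖u z - u (z.1, y0)‖^2) ∂(μP d n) with hT2
  have m1 : Measurable T1 := by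
    have : Continuous fun w : (Fin n → ℝ) × (Fin d → ℝ) =>
        ENNReal.ofReal (∑ i, ‖dX d n i u (w.2,w.1)‖^2) :=
      ENNReal.continuous_ofReal.comp (by fun_prop)
    exact this.measurable.lintegral_prod_right'
  have m2 : Measurable T2 := by
    have : Continuous fun w : (Fin n → ℝ) × Pt d n =>
        ENNReal.ofReal (‖u w.2 - u (w.2.1, w.1)‖^2) :=
      ENNReal.continuous_ofReal.comp (by fun_prop)
    exact this.measurable.lintegral_prod_right'
  have i1 : ∫⁻ y0, T1 y0 ∂(μT n) = ENNReal.ofReal (gradXSq d n u) := by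
    unfold gradXSq
    rw [ofReal_integral_eq_lintegral_ofReal hr.X (Eventually.of_forall fun z => by positivity), μP,
      lintegral_prod_symm]
    have : Continuous fun z : Pt d n => ENNReal.ofReal (∑ j, ‖dX d n j u z‖^2) :=
      ENNReal.continuous_ofReal.comp (by fun_prop)
    exact this.measurable.aemeasurable
  have i2 : ∫⁻ y0, T2 y0 ∂(μT n) ≤ ENNReal.ofReal (Cp n) * ENNReal.ofReal (gradYSq d n u) :=
    poincare_Pt hr
  set K := gradXSq d n u + s * (Cp n * gradYSq d n u) with hK
  have hA := gradXSq_nonneg d n u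
  have hG := gradYSq_nonneg d n u
  have hC := Cp_nonneg n
  have hK0 : 0 ≤ K := by positivity
  have i3 : ∫⁻ y0, (T1 y0 + ENNReal.ofReal s * T2 y0) ∂(μT n) ≤ ENNReal.ofReal K := by
    rw [lintegral_add_left m1, lintegral_const_mul' _ _ ENNReal.ofReal_ne_top, i1, hK,
      ENNReal.ofReal_add hA (by positivity), ENNReal.ofReal_mul hs.le, ENNReal.ofReal_mul hC]
    gcongr
  have hV : (0:ℝ) < (2*π)^n := by positivity
  have hμ0 : μT n ≠ 0 := by
    intro h
    have := μT_univ n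
    rw [h] at this
    simp only [Measure.coe_zero, Pi.zero_apply] at this
    exact absurd this.symm (by simpa using hV)
  obtain ⟨y0, hy0, hle⟩ := exists_notMem_null_le_laverage hμ0
    (m1.add (m2.const_mul (ENNReal.ofReal s))).aemeasurable (ae_iff.1 (slice_InH2d hu))
  have hH : InH2d d (fun x => u (x, y0)) := by simpa using hy0
  have hle2 : ENNReal.ofReal ((2*π)^n) * (T1 y0 + ENNReal.ofReal s * T2 y0) ≤ ENNReal.ofReal K := by
    rw [laverage_eq, μT_univ, ENNReal.le_div_iff_mul_le (Or.inl (by simpa using hV))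
      (Or.inl ENNReal.ofReal_ne_top)] at hle
    rw [mul_comm]
    exact hle.trans i3
  rw [mul_add] at hle2
  refine ⟨fun x => u (x,y0), hH, ?_, ?_⟩
  · have h1 : T1 y0 = ENNReal.ofReal (gradSqd d (fun x => u (x,y0))) := by
      unfold gradSqd
      rw [ofReal_integral_eq_lintegral_ofReal hH.2.2.1 (Eventually.of_forall fun z => by positivity)]
      simp only [hT1, slice_fderiv hr.c1]
    have h2 := (le_self_add).trans hle2
    rw [h1, ← ENNReal.ofReal_mul hV.le] at h2
    exact (ENNReal.ofReal_le_ofReal_iff hK0).1 h2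
  · have h2 := (le_add_self).trans hle2
    have hc : Continuous fun z : Pt d n => ‖u z - u (z.1, y0)‖^2 := by fun_prop
    have h1 : T2 y0 = ENNReal.ofReal (Mass d n (fun z => u z - cyl d n (fun x => u (x,y0)) z)) := by
      unfold Mass
      rw [ofReal_integral_eq_lintegral_ofReal]
      · rfl
      · refine ⟨hc.aestronglyMeasurable, ?_⟩
        rw [hasFiniteIntegral_iff_ofReal (Eventually.of_forall fun z => by positivity)]
        by_contra hcon
        have htop : T2 y0 = ⊤ := by simpa [hT2, cyl] using hcon
        rw [htop, ENNReal.mul_top (by simpa using hs), ENNReal.mul_top (by simpa using hV)] at h2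
        exact absurd h2 (by simp)
      · exact Eventually.of_forall fun z => by positivity
    rw [h1, ← ENNReal.ofReal_mul hs.le, ← ENNReal.ofReal_mul hV.le] at h2
    have := (ENNReal.ofReal_le_ofReal_iff hK0).1 h2
    linarith

end BNLS

end

section
open MeasureTheory Real Filter Set
open scoped ENNReal Topology

namespace BNLS

lemma mink {Ω : Type*} [MeasurableSpace Ω] (μ : Measure Ω) (f g : Ω → ℂ) (p : ℝ) (hp : 1 ≤ p)
    (hf : AEStronglyMeasurable f μ) (hg : AEStronglyMeasurable g μ)
    (hfi : Integrable (fun z => ‖f z‖^p) μ) (hgi : Integrable (fun z => ‖g z‖^p) μ) :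
    (∫ z, ‖f z + g z‖^p ∂μ)^(1/p) ≤ (∫ z, ‖f z‖^p ∂μ)^(1/p) + (∫ z, ‖g z‖^p ∂μ)^(1/p) := by
  have hp0 : 0 < p := by linarith
  have q0 : ENNReal.ofReal p ≠ 0 := by simpa using hp0
  have qt : ENNReal.ofReal p ≠ ⊤ := ENNReal.ofReal_ne_top
  have tr : (ENNReal.ofReal p).toReal = p := ENNReal.toReal_ofReal hp0.le
  have mf : MemLp f (ENNReal.ofReal p) μ := by
    rw [← integrable_norm_rpow_iff hf q0 qt, tr]; exact hfi
  have mg : MemLp g (ENNReal.ofReal p) μ := by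
    rw [← integrable_norm_rpow_iff hg q0 qt, tr]; exact hgi
  have h := eLpNorm_add_le hf hg (by simpa using hp : 1 ≤ ENNReal.ofReal p)
  rw [(mf.add mg).eLpNorm_eq_integral_rpow_norm q0 qt, mf.eLpNorm_eq_integral_rpow_norm q0 qt,
    mg.eLpNorm_eq_integral_rpow_norm q0 qt, tr, ← ENNReal.ofReal_add (by positivity) (by positivity),
    ENNReal.ofReal_le_ofReal_iff (by positivity)] at h
  simpa [one_div] using h

lemma mink2 {Ω : Type*} [MeasurableSpace Ω] (μ : Measure Ω) (f g : Ω → ℂ)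
    (hf : AEStronglyMeasurable f μ) (hg : AEStronglyMeasurable g μ)
    (hfi : Integrable (fun z => ‖f z‖^2) μ) (hgi : Integrable (fun z => ‖g z‖^2) μ) :
    √(∫ z, ‖f z + g z‖^2 ∂μ) ≤ √(∫ z, ‖f z‖^2 ∂μ) + √(∫ z, ‖g z‖^2 ∂μ) := by
  have := mink μ f g 2 (by norm_num) hf hg (by simpa using hfi) (by simpa using hgi)
  simpa [Real.sqrt_eq_rpow] using this

lemma diff_reg {d n : ℕ} {u : Pt d n → ℂ} (hu : Reg d n u) {v : (Fin d → ℝ) → ℂ} (hv : InH2d d v) :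
    Reg d n (fun z => u z - cyl d n v z) ∧
    gradXSq d n (fun z => u z - cyl d n v z) ≤ 2 * gradXSq d n u + 2 * ((2*π)^n * gradSqd d v) ∧
    gradYSq d n (fun z => u z - cyl d n v z) = gradYSq d n u := by
  have hc : Reg d n (cyl d n v) := (cyl_InH2 hv).reg
  have h1 : ContDiff ℝ 1 v := hv.1.of_le (by norm_num)
  have cX := dX_cont hu.c1
  have cXv := dX_cont hc.c1
  have dx : ∀ i z, dX d n i (fun z => u z - cyl d n v z) z = dX d n i u z - dX d n i (cyl d n v) z := by
    intro i z
    unfold dX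
    rw [fderiv_fun_sub (hu.c1.differentiable one_ne_zero z) (hc.c1.differentiable one_ne_zero z)]
    rfl
  have dy : ∀ j, dY d n j (fun z => u z - cyl d n v z) = dY d n j u := by
    intro j
    ext z
    have : dY d n j (cyl d n v) z = 0 := by rw [dY_cyl h1]; rfl
    unfold dY at *
    rw [fderiv_fun_sub (hu.c1.differentiable one_ne_zero z) (hc.c1.differentiable one_ne_zero z),
      ContinuousLinearMap.sub_apply, this, sub_zero]
  have sq : ∀ a b : ℂ, ‖a - b‖^2 ≤ 2 * ‖a‖^2 + 2 * ‖b‖^2 := by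
    intro a b
    have := norm_sub_le a b
    nlinarith [norm_nonneg (a-b), sq_nonneg (‖a‖-‖b‖), norm_nonneg a, norm_nonneg b]
  have hXs : Integrable (fun z => 2 * (∑ i, ‖dX d n i u z‖^2) + 2 * ∑ i, ‖dX d n i (cyl d n v) z‖^2)
      (μP d n) := (hu.X.const_mul 2).add (hc.X.const_mul 2)
  have hXle : ∀ z, ∑ i, ‖dX d n i (fun z => u z - cyl d n v z) z‖^2 ≤
      2 * (∑ i, ‖dX d n i u z‖^2) + 2 * ∑ i, ‖dX d n i (cyl d n v) z‖^2 := by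
    intro z
    rw [Finset.mul_sum, Finset.mul_sum, ← Finset.sum_add_distrib]
    apply Finset.sum_le_sum
    intro i _
    rw [dx]
    exact sq _ _
  have hX : Integrable (fun z => ∑ i, ‖dX d n i (fun z => u z - cyl d n v z) z‖^2) (μP d n) := by
    refine hXs.mono' ?_ (Eventually.of_forall fun z => ?_)
    · simp only [dx]
      exact (by fun_prop : Continuous fun z => ∑ i, ‖dX d n i u z - dX d n i (cyl d n v) z‖^2).aestronglyMeasurable
    · rw [Real.norm_of_nonneg (by positivity)]
      exact hXle z
  have uc := hu.c1.continuous
  have vc := hc.c1.continuous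
  refine ⟨⟨hu.c1.sub hc.c1, ?_, hX, ?_⟩, ?_, ?_⟩
  · refine ((hu.M.const_mul 2).add (hc.M.const_mul 2)).mono'
      (by fun_prop : Continuous fun z => ‖u z - cyl d n v z‖^2).aestronglyMeasurable
      (Eventually.of_forall fun z => ?_)
    rw [Real.norm_of_nonneg (by positivity)]
    exact sq _ _
  · simp only [dy]; exact hu.Y
  · rw [← gradXSq_cyl h1]
    unfold gradXSq
    rw [← integral_const_mul, ← integral_const_mul, ← integral_add (hu.X.const_mul 2) (hc.X.const_mul 2)]
    exact integral_mono hX hXs hXle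
  · unfold gradYSq; simp only [dy]

lemma compare_mass {d n : ℕ} {u : Pt d n → ℂ} (hu : Reg d n u) {v : (Fin d → ℝ) → ℂ} (hv : InH2d d v) :
    √(Mass d n u) ≤ √((2*π)^n * Massd d v) + √(Mass d n (fun z => u z - cyl d n v z)) ∧
    √((2*π)^n * Massd d v) ≤ √(Mass d n u) + √(Mass d n (fun z => u z - cyl d n v z)) := by
  have hc : Reg d n (cyl d n v) := (cyl_InH2 hv).reg
  have hw := (diff_reg hu hv).1
  rw [← Mass_cyl]
  constructor
  · have := mink2 (μP d n) (cyl d n v) (fun z => u z - cyl d n v z) hc.c1.continuous.aestronglyMeasurable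
      hw.c1.continuous.aestronglyMeasurable hc.M hw.M
    simpa [Mass] using this
  · have := mink2 (μP d n) u (fun z => cyl d n v z - u z) hu.c1.continuous.aestronglyMeasurable
      (hc.c1.continuous.sub hu.c1.continuous).aestronglyMeasurable hu.M
      (by simpa only [norm_sub_rev] using hw.M)
    simpa [Mass, norm_sub_rev] using this

lemma compare_pow {d n : ℕ} (hd : 1 ≤ d) (hn : 1 ≤ n) (p : ℝ) (hp : 2 < p)
    (hpq : p < 2 + 4/((d:ℝ)+n)) {u : Pt d n → ℂ} (hu : Reg d n u) {v : (Fin d → ℝ) → ℂ} (hv : InH2d d v) :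
    (Npow d n p u)^(1/p) ≤ ((2*π)^n * Npowd d p v)^(1/p) +
      (Npow d n p (fun z => u z - cyl d n v z))^(1/p) := by
  have hc : Reg d n (cyl d n v) := (cyl_InH2 hv).reg
  have hw := (diff_reg hu hv).1
  rw [← Npow_cyl]
  have := mink (μP d n) (cyl d n v) (fun z => u z - cyl d n v z) p (by linarith)
    hc.c1.continuous.aestronglyMeasurable
    hw.c1.continuous.aestronglyMeasurable (Npow_bound hd hn p 1 hp hpq one_pos hc).1
    (Npow_bound hd hn p 1 hp hpq one_pos hw).1
  simpa only [Npow, add_sub_cancel] using this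

lemma exists_adm {d n : ℕ} {u : Pt d n → ℂ} (hu : u ∈ Sset d n 1) :
    ∃ v : (Fin d → ℝ) → ℂ, InH2d d v ∧ Massd d v = ((2*π)^n)⁻¹ := by
  have hr := hu.1.reg
  have hex : ∃ y, InH2d d (fun x => u (x,y)) ∧ Massd d (fun x => u (x,y)) ≠ 0 := by
    by_contra hcon
    push Not at hcon
    have h1 : Mass d n u = ∫ y, Massd d (fun x => u (x,y)) ∂(μT n) := by
      unfold Mass
      rw [μP, integral_prod_symm _ hr.M]
      rfl
    rw [hu.2, integral_eq_zero_of_ae] at h1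
    · exact one_ne_zero h1
    · filter_upwards [slice_InH2d hu.1] with y hy using hcon y hy
  obtain ⟨y, hy, hm⟩ := hex
  have hm0 : 0 < Massd d (fun x => u (x,y)) :=
    lt_of_le_of_ne (integral_nonneg fun _ => by positivity) hm.symm
  have hV : (0:ℝ) < (2*π)^n := by positivity
  refine ⟨_, scale_InH2d hy (√((2*π)^n * Massd d (fun x => u (x,y))))⁻¹, ?_⟩
  rw [scale_Massd, inv_pow, Real.sq_sqrt (by positivity)]
  field_simp

end BNLS

end

section
open MeasureTheory Real Filter Set
open scoped ENNReal Topology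

namespace BNLS

lemma tangent (p a b : ℝ) (hp : 1 ≤ p) (ha : 0 ≤ a) (hb : 0 ≤ b) :
    a^p - b^p ≤ p * (a^(p-1) * (a - b)) := by
  rcases ha.eq_or_lt with rfl | ha
  · rw [Real.zero_rpow (by linarith)]
    have h1 : 0 ≤ b^p := by positivity
    rcases hp.eq_or_lt with rfl | hp
    · simp
    · rw [Real.zero_rpow (by linarith)]; linarith
  have h := one_add_mul_self_le_rpow_one_add (s := b/a - 1) (by linarith [div_nonneg hb ha.le]) hp
  have e : (1 + (b/a - 1)) = b/a := by ring
  rw [e, Real.div_rpow hb ha.le, le_div_iff₀ (by positivity)] at h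
  have e2 : a^p = a^(p-1) * a := by
    rw [← Real.rpow_add_one ha.ne']; ring_nf
  have e3 : (1 + p * (b/a - 1)) * a^p = a^p + p * (a^(p-1) * (b - a)) := by
    rw [e2]; field_simp
  rw [e3] at h
  linarith

lemma real_low (β p a q A C2 A0 δ X Y C3 ω E : ℝ) (hβ : 0 < β) (hp : 2 < p)
    (h1 : 1 ≤ a + q) (h2 : a ≤ 1 + q) (hq0 : 0 ≤ q) (hq : q ≤ 1/2)
    (hA : 0 ≤ A) (hAC : A ≤ C2) (hδ : 0 ≤ δ) (hA0 : A0 ≤ A + δ) (hX : 0 ≤ X) (hXC : X ≤ C3)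
    (hY : 0 ≤ Y) (hω : 0 ≤ ω) (hXY : X ≤ Y + ω) (hE : (β/2) * A - (1/p) * X^p ≤ E) :
    (β/2) * (a⁻¹^2 * A0) - (1/p) * (a⁻¹ * Y)^p ≤
      E + ((β/2) * (6 * q * C2 + 4 * δ) + C3^(p-1) * (2 * q * C3 + 2 * ω)) := by
  have ha : 1/2 ≤ a := by linarith
  have ha0 : 0 < a := by linarith
  set l := a⁻¹ with hl
  have hl0 : 0 < l := by positivity
  have hal : a * l = 1 := mul_inv_cancel₀ ha0.ne'
  have hl2 : l ≤ 2 := by nlinarith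
  have k1 : l - 1 ≤ 2 * q := by
    have : l - 1 = l * (1 - a) := by linarith [hal, mul_comm a l]
    rw [this]; nlinarith
  have k2 : 1 - l ≤ 2 * q := by
    have : 1 - l = l * (a - 1) := by linarith [hal, mul_comm a l]
    rw [this]; nlinarith
  have k3 : l^2 * A0 ≤ A + (6 * q * C2 + 4 * δ) := by
    have s1 : l^2 * A0 ≤ l^2 * (A + δ) := by gcongr
    have s2 : l^2 ≤ 4 := by nlinarith
    have s3 : l^2 - 1 ≤ 6 * q := by nlinarith
    have s4 : (l^2 - 1) * A ≤ 6 * q * C2 := by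
      calc _ ≤ 6 * q * A := by gcongr
        _ ≤ _ := by gcongr
    nlinarith
  have k4 := tangent p X (l * Y) (by linarith) hX (by positivity)
  have k5 : X^(p-1) * (X - l * Y) ≤ C3^(p-1) * (2 * q * C3 + 2 * ω) := by
    have s1 : X - l * Y ≤ 2 * q * C3 + 2 * ω := by
      have t1 : l * (X - ω) ≤ l * Y := by gcongr; linarith
      have t2 : (1 - l) * X ≤ 2 * q * C3 := by
        calc _ ≤ 2 * q * X := by gcongr
          _ ≤ _ := by gcongr
      have t3 : l * ω ≤ 2 * ω := by gcongr
      nlinarith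
    have s2 : X^(p-1) ≤ C3^(p-1) := Real.rpow_le_rpow hX hXC (by linarith)
    have s3 : 0 ≤ C3 := hX.trans hXC
    calc _ ≤ X^(p-1) * (2 * q * C3 + 2 * ω) := by gcongr
      _ ≤ _ := by gcongr
  have k6 : (1/p) * (X^p - (l*Y)^p) ≤ C3^(p-1) * (2 * q * C3 + 2 * ω) := by
    calc _ ≤ (1/p) * (p * (X^(p-1) * (X - l * Y))) := by gcongr
      _ = X^(p-1) * (X - l * Y) := by field_simp
      _ ≤ _ := k5
  have k7 : (β/2) * (l^2 * A0) ≤ (β/2) * (A + (6 * q * C2 + 4 * δ)) := by gcongr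
  linarith

/-- Explicit error. -/
noncomputable def errF (β p e C0 C2 C3 K1 K2 r : ℝ) : ℝ :=
  (β/2) * (6 * √(K1 * r) * C2 + 4 * (K2 * r)) + C3^(p-1) * (2 * √(K1 * r) * C3 +
    2 * (C0 * (K1*r)^e * (K1 * r + (5 * C2 + 2 * (K2 * r))) + K1 * r)^(1/p))

lemma errF_tendsto (β p e C0 C2 C3 K1 K2 : ℝ) (hp : 0 < p) (he : 0 < e) :
    Tendsto (errF β p e C0 C2 C3 K1 K2) (𝓝 0) (𝓝 0) := by
  have hc : Continuous (errF β p e C0 C2 C3 K1 K2) := by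
    unfold errF
    have h1 : Continuous fun r : ℝ => (K1 * r)^e :=
      (continuous_const.mul continuous_id).rpow_const fun _ => Or.inr he.le
    have h2 : Continuous fun r : ℝ => (C0 * (K1*r)^e * (K1 * r + (5 * C2 + 2 * (K2 * r))) + K1 * r)^(1/p) :=
      Continuous.rpow_const (by fun_prop) fun _ => Or.inr (by positivity)
    fun_prop
  have h0 : errF β p e C0 C2 C3 K1 K2 0 = 0 := by
    unfold errF
    simp [Real.zero_rpow he.ne', Real.zero_rpow (inv_ne_zero hp.ne')]
  have := hc.tendsto 0
  rwa [h0] at this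

set_option maxHeartbeats 1000000 in
lemma low {d n : ℕ} (hd : 1 ≤ d) (hn : 1 ≤ n) (β α : ℝ)
    (hβ : 0 < β) (hα : 0 < α) (hα' : α < 4 / ((d:ℝ)+n)) (C2 : ℝ) (hC2 : 0 ≤ C2) :
    ∃ C3 K1 K2 : ℝ, 0 ≤ K1 ∧ ∀ u ∈ Sset d n 1, ∀ τ : ℝ, 1 ≤ τ →
      gradXSq d n u + τ * gradYSq d n u ≤ C2 → √(K1 * (√τ)⁻¹) ≤ 1/2 →
      ∃ v : (Fin d → ℝ) → ℂ, InH2d d v ∧ Massd d v = ((2*π)^n)⁻¹ ∧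
        (2*π)^n * ((β/2) * gradSqd d v - (1/(α+2)) * Npowd d (α+2) v) ≤
          Etau d n τ β α u + errF β (α+2) (2/((d:ℝ)+n)) (9*((d:ℝ)+n+1)) C2 C3 K1 K2 (√τ)⁻¹ := by
  have hV : (0:ℝ) < (2*π)^n := by positivity
  have hCp := Cp_nonneg n
  have hdn : (0:ℝ) < (d:ℝ)+n := by positivity
  set C0 := 9*((d:ℝ)+n+1) with hC0
  have hC00 : 0 ≤ C0 := by positivity
  set e := 2/((d:ℝ)+n) with he
  have he0 : 0 < e := by positivity
  set K2 := Cp n * C2 with hK2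
  set K1 := (C2 + K2) / (2*π)^n with hK1
  have hK20 : 0 ≤ K2 := by positivity
  have hK10 : 0 ≤ K1 := by positivity
  refine ⟨(C0 * (1 + C2 + C2) + 1)^(1/(α+2)), K1, K2, hK10, ?_⟩
  intro u hu τ hτ hbd hsm
  have hτ0 : 0 < τ := by linarith
  have hs : 0 < √τ := Real.sqrt_pos.2 hτ0
  have hs1 : 1 ≤ √τ := by rw [Real.one_le_sqrt]; exact hτ
  set r := (√τ)⁻¹ with hr
  have hr0 : 0 < r := by positivity
  have hr1 : r ≤ 1 := inv_le_one_of_one_le₀ hs1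
  have hreg := hu.1.reg
  obtain ⟨v, hv, hA0, hP⟩ := slice_sel hu.1 (√τ) hs
  have hv1 : ContDiff ℝ 1 v := hv.1.of_le (by norm_num)
  obtain ⟨hw, hwX, hwY⟩ := diff_reg hreg hv
  obtain ⟨m1, m2⟩ := compare_mass hreg hv
  have hpw := compare_pow hd hn (α+2) (by linarith) (by linarith) hreg hv
  have hNw := (Npow_bound hd hn (α+2) 1 (by linarith) (by linarith) one_pos hw).2
  have hN := (Npow_bound hd hn (α+2) 1 (by linarith) (by linarith) one_pos hreg).2
  have n1 := gradXSq_nonneg d n u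
  have n2 := gradYSq_nonneg d n u
  have n3 := lapXSq_nonneg d n u
  have n4 := lapYSq_nonneg d n u
  have n5 := Npow_nonneg d n (α+2) u
  have n6 := Mass_nonneg d n (fun z => u z - cyl d n v z)
  have n7 := Npow_nonneg d n (α+2) (fun z => u z - cyl d n v z)
  have n8 : 0 ≤ Npowd d (α+2) v := integral_nonneg fun _ => by positivity
  have n9 : 0 ≤ Massd d v := integral_nonneg fun _ => by positivity
  have n10 : 0 ≤ gradSqd d v := integral_nonneg fun _ => by positivity
  rw [hwY] at hNw
  set P := Mass d n (fun z => u z - cyl d n v z) with hPd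
  set Ω := Npow d n (α+2) (fun z => u z - cyl d n v z) with hΩ
  set Xw := gradXSq d n (fun z => u z - cyl d n v z) with hXw
  set A := gradXSq d n u with hAd
  set G := gradYSq d n u with hGd
  set N := Npow d n (α+2) u with hNd
  rw [hu.2] at hN m1 m2
  simp only [Real.one_rpow, one_mul, mul_one, Real.sqrt_one] at hN hNw m1 m2
  have hτG0 : 0 ≤ τ * G := mul_nonneg hτ0.le n2
  have hA : A ≤ C2 := by linarith only [hτG0, hbd]
  have hτG : τ * G ≤ C2 := by linarith only [n1, hbd]
  have hG : G ≤ C2 := (le_mul_of_one_le_left n2 hτ).trans hτG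
  have hsG : √τ * G ≤ C2 * r := by
    have : √τ * √τ = τ := Real.mul_self_sqrt hτ0.le
    rw [hr, ← div_eq_mul_inv, le_div_iff₀ hs]
    calc _ = (√τ * √τ) * G := by ring
      _ ≤ _ := by rw [this]; exact hτG
  have hδ : √τ * (Cp n * G) ≤ K2 * r := by
    calc _ = Cp n * (√τ * G) := by ring
      _ ≤ Cp n * (C2 * r) := by gcongr
      _ = _ := by rw [hK2]; ring
  have hA0' : (2*π)^n * gradSqd d v ≤ A + K2 * r := by linarith only [hA0, hδ]
  have hPb : P ≤ K1 * r := by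
    have h1 : √τ * ((2*π)^n * P) ≤ C2 + K2 := by
      have : K2 * r ≤ K2 := mul_le_of_le_one_right hK20 hr1
      linarith only [this, hP, hδ, hA]
    rw [hK1, hr, ← div_eq_mul_inv, le_div_iff₀ hs, le_div_iff₀ hV]
    linarith
  have hΩb : Ω ≤ C0 * (K1*r)^e * (K1 * r + (5 * C2 + 2 * (K2 * r))) + K1 * r := by
    refine hNw.trans ?_
    have : P^e ≤ (K1*r)^e := Real.rpow_le_rpow n6 hPb he0.le
    have hX0 : 0 ≤ Xw := gradXSq_nonneg _ _ _
    have hsum : P + Xw + G ≤ K1 * r + (5 * C2 + 2 * (K2 * r)) := by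
      linarith only [hPb, hwX, hA0', hA, hG]
    exact add_le_add (mul_le_mul (mul_le_mul_of_nonneg_left this hC00) hsum (by positivity)
      (by positivity)) hPb
  have hsq : √P ≤ √(K1 * r) := Real.sqrt_le_sqrt hPb
  set a := √((2*π)^n * Massd d v) with ha
  have hNb : N ≤ C0 * (1 + C2 + C2) + 1 := by
    refine hN.trans ?_
    gcongr
  have hp0 : 0 < 1/(α+2) := by positivity
  have hXp : (N^(1/(α+2)))^(α+2) = N := by
    rw [← Real.rpow_mul n5, one_div, inv_mul_cancel₀ (by linarith), Real.rpow_one]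
  have hYp : (((2*π)^n * Npowd d (α+2) v)^(1/(α+2)))^(α+2) = (2*π)^n * Npowd d (α+2) v := by
    rw [← Real.rpow_mul (by positivity), one_div, inv_mul_cancel₀ (by linarith), Real.rpow_one]
  have key := real_low β (α+2) a (√(K1*r)) A C2 ((2*π)^n * gradSqd d v) (K2 * r) (N^(1/(α+2)))
    (((2*π)^n * Npowd d (α+2) v)^(1/(α+2))) ((C0 * (1 + C2 + C2) + 1)^(1/(α+2)))
    ((C0 * (K1*r)^e * (K1 * r + (5 * C2 + 2 * (K2 * r))) + K1 * r)^(1/(α+2)))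
    (Etau d n τ β α u) hβ (by linarith) (by linarith) (by linarith) (by positivity) hsm n1 hA
    (by positivity) hA0' (by positivity) (Real.rpow_le_rpow n5 hNb hp0.le) (by positivity)
    (by positivity) (hpw.trans (by gcongr)) (by
      rw [hXp]
      have h9 : 0 ≤ 1/(2*τ) * lapXSq d n u := by positivity
      have h10 : 0 ≤ τ/2 * lapYSq d n u := by positivity
      have h11 : 0 ≤ β*τ/2 * gradYSq d n u := by positivity
      unfold Etau
      linarith)
  have ha0 : 0 < a := by linarith
  have hm : 0 < (2*π)^n * Massd d v := Real.sqrt_pos.1 ha0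
  have haa : a^2 = (2*π)^n * Massd d v := Real.sq_sqrt hm.le
  refine ⟨_, scale_InH2d hv a⁻¹, ?_, ?_⟩
  · rw [scale_Massd, inv_pow, haa]
    have : Massd d v ≠ 0 := fun h => by rw [h] at hm; simp at hm
    field_simp
  · rw [scale_gradSqd hv1, scale_Npowd _ _ _ _ (by positivity)]
    rw [Real.mul_rpow (by positivity) (by positivity), hYp] at key
    unfold errF
    linarith

end BNLS

end

open BNLS in
/-- `lim_{τ→∞} μ_{1,τ} = (2π)^n μ̂^∞_{(2π)^{-n}}` for `β > 0`,
`0 < α < 4/(d+n)`. -/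
theorem stmt_18 (d n : ℕ) (hd : 1 ≤ d) (hn : 1 ≤ n) (β α : ℝ)
    (hβ : 0 < β) (hα : 0 < α) (hα' : α < 4 / ((d:ℝ)+n))
    (hmin : ∀ τ : ℝ, 0 < τ → ∃ u ∈ Sset d n 1, Etau d n τ β α u = mu1tau d n τ β α) :
    Tendsto (fun τ => mu1tau d n τ β α) atTop
      (nhds ((2*π) ^ (n:ℝ) * muHatInf d β α ((2*π) ^ (-(n:ℝ))))) := by
  rw [Real.rpow_neg (by positivity), Real.rpow_natCast]
  have hV : (0:ℝ) < (2*π)^n := by positivity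
  obtain ⟨C1, hC1, hco⟩ := coercive d n hd hn β α hβ hα hα'
  -- admissible functions give upper bounds
  have hS : ∀ v : (Fin d → ℝ) → ℂ, InH2d d v → Massd d v = ((2*π)^n)⁻¹ → cyl d n v ∈ Sset d n 1 := by
    intro v hv hm
    refine ⟨cyl_InH2 hv, ?_⟩
    rw [Mass_cyl, hm, mul_inv_cancel₀ hV.ne']
  have hbdd : ∀ τ : ℝ, 1 ≤ τ → ∀ u ∈ Sset d n 1, -C1 ≤ Etau d n τ β α u := by
    intro τ hτ u hu
    have h := hco u hu τ hτ
    have h1 := gradXSq_nonneg d n u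
    have h2 := gradYSq_nonneg d n u
    have h3 : 0 ≤ (β/4) * (gradXSq d n u + τ * gradYSq d n u) := by positivity
    linarith
  have hup : ∀ τ : ℝ, 1 ≤ τ → ∀ v : (Fin d → ℝ) → ℂ, InH2d d v → Massd d v = ((2*π)^n)⁻¹ →
      mu1tau d n τ β α ≤ (2*π)^n * ((β/2) * gradSqd d v - (1/(α+2)) * Npowd d (α+2) v)
        + (2*π)^n * lapSqd d v / 2 * τ⁻¹ := by
    intro τ hτ v hv hm
    rw [← Etau_cyl τ β α hv.1]
    refine csInf_le ⟨-C1, ?_⟩ (mem_image_of_mem _ (hS v hv hm))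
    rintro _ ⟨u, hu, rfl⟩
    exact hbdd τ hτ u hu
  have hlim : ∀ a b : ℝ, Tendsto (fun τ : ℝ => a + b * τ⁻¹) atTop (nhds a) := by
    intro a b
    simpa using (tendsto_inv_atTop_zero.const_mul b).const_add a
  have hbl : ∀ v : (Fin d → ℝ) → ℂ, InH2d d v → Massd d v = ((2*π)^n)⁻¹ →
      -C1 ≤ (2*π)^n * ((β/2) * gradSqd d v - (1/(α+2)) * Npowd d (α+2) v) := by
    intro v hv hm
    refine ge_of_tendsto (hlim _ ((2*π)^n * lapSqd d v / 2)) ?_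
    filter_upwards [eventually_ge_atTop 1] with τ hτ
    rw [← Etau_cyl τ β α hv.1]
    exact hbdd τ hτ _ (hS v hv hm)
  have hmu : ∀ v : (Fin d → ℝ) → ℂ, InH2d d v → Massd d v = ((2*π)^n)⁻¹ →
      muHatInf d β α ((2*π)^n)⁻¹ ≤ (β/2) * gradSqd d v - (1/(α+2)) * Npowd d (α+2) v := by
    intro v hv hm
    refine csInf_le ⟨-C1/(2*π)^n, ?_⟩ ⟨v, hv, hm, rfl⟩
    rintro _ ⟨v, hv, hm, rfl⟩
    rw [div_le_iff₀ hV, mul_comm]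
    exact hbl v hv hm
  obtain ⟨u1, hu1, -⟩ := hmin 1 one_pos
  obtain ⟨v0, hv0, hm0⟩ := exists_adm hu1
  set K := (2*π)^n * ((β/2) * gradSqd d v0 - (1/(α+2)) * Npowd d (α+2) v0)
    + (2*π)^n * lapSqd d v0 / 2 with hK
  have hl0 : 0 ≤ lapSqd d v0 := integral_nonneg fun _ => by positivity
  have hKb : ∀ τ : ℝ, 1 ≤ τ → mu1tau d n τ β α ≤ K := by
    intro τ hτ
    refine (hup τ hτ v0 hv0 hm0).trans ?_
    have h1 : τ⁻¹ ≤ 1 := inv_le_one_of_one_le₀ hτ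
    have : (2*π)^n * lapSqd d v0 / 2 * τ⁻¹ ≤ (2*π)^n * lapSqd d v0 / 2 :=
      mul_le_of_le_one_right (by positivity) h1
    linarith
  have hKC : 0 ≤ K + C1 := by
    have := (hbdd 1 le_rfl u1 hu1)
    have h2 := hbl v0 hv0 hm0
    have : 0 ≤ (2*π)^n * lapSqd d v0 / 2 := by positivity
    linarith
  obtain ⟨C3, K1, K2, hK1, hlow⟩ := low hd hn β α hβ hα hα' ((K + C1) / (β/4)) (by positivity)
  have hr : Tendsto (fun τ : ℝ => (√τ)⁻¹) atTop (nhds 0) :=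
    tendsto_inv_atTop_zero.comp Real.tendsto_sqrt_atTop
  have herr := (errF_tendsto β (α+2) (2/((d:ℝ)+n)) (9*((d:ℝ)+n+1)) ((K + C1) / (β/4)) C3 K1 K2
    (by linarith) (by positivity)).comp hr
  have hsm : Tendsto (fun τ : ℝ => √(K1 * (√τ)⁻¹)) atTop (nhds 0) := by
    have := (Real.continuous_sqrt.tendsto _).comp (hr.const_mul K1)
    rw [mul_zero, Real.sqrt_zero] at this
    exact this
  have hlowE : ∀ᶠ τ in atTop, (2*π)^n * muHatInf d β α ((2*π)^n)⁻¹ -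
      errF β (α+2) (2/((d:ℝ)+n)) (9*((d:ℝ)+n+1)) ((K + C1) / (β/4)) C3 K1 K2 (√τ)⁻¹ ≤
        mu1tau d n τ β α := by
    filter_upwards [eventually_ge_atTop 1, hsm.eventually_lt_const (by norm_num : (0:ℝ) < 1/2)]
      with τ hτ hs
    obtain ⟨u, hu, hE⟩ := hmin τ (by linarith)
    have hbd : gradXSq d n u + τ * gradYSq d n u ≤ (K + C1) / (β/4) := by
      rw [le_div_iff₀ (by positivity), mul_comm]
      have h1 := hco u hu τ hτ
      have h2 := hKb τ hτ
      linarith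
    obtain ⟨v, hv, hm, hle⟩ := hlow u hu τ hτ hbd hs.le
    have h1 := mul_le_mul_of_nonneg_left (hmu v hv hm) hV.le
    linarith
  rw [tendsto_order]
  constructor
  · intro a ha
    have h1 : Tendsto (fun τ : ℝ => (2*π)^n * muHatInf d β α ((2*π)^n)⁻¹ -
      errF β (α+2) (2/((d:ℝ)+n)) (9*((d:ℝ)+n+1)) ((K + C1) / (β/4)) C3 K1 K2 (√τ)⁻¹) atTop
        (nhds ((2*π)^n * muHatInf d β α ((2*π)^n)⁻¹)) := by
      simpa using herr.const_sub ((2*π)^n * muHatInf d β α ((2*π)^n)⁻¹)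
    filter_upwards [hlowE, h1.eventually_const_lt ha] with τ h2 h3
    exact h3.trans_le h2
  · intro b hb
    have hb' : muHatInf d β α ((2*π)^n)⁻¹ < b / (2*π)^n := by
      rw [lt_div_iff₀ hV, mul_comm]; exact hb
    unfold muHatInf at hb'
    obtain ⟨_, ⟨v, hv, hm, rfl⟩, hlt⟩ := exists_lt_of_csInf_lt
      (Set.nonempty_of_mem (s := {r : ℝ | ∃ u : (Fin d → ℝ) → ℂ, InH2d d u ∧
        Massd d u = ((2*π)^n)⁻¹ ∧ r = (β/2) * gradSqd d u - (1/(α+2)) * Npowd d (α+2) u})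
        ⟨v0, hv0, hm0, rfl⟩) hb'
    rw [lt_div_iff₀ hV, mul_comm] at hlt
    filter_upwards [eventually_ge_atTop 1,
      (hlim _ ((2*π)^n * lapSqd d v / 2)).eventually_lt_const hlt] with τ hτ h2
    exact (hup τ hτ v hv hm).trans_lt h2
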